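/- arXiv:1201.4769 — 7 statements merged into one kernel-verified Lean document; each statement's English description precedes it below -/
import Mathlib

section
/- Let n ≥ 2 and let U ⊆ ℂⁿ be an open set. Let ξ, η : U → ℂⁿ be holomorphic maps (vector fields) such that for every w ∈ U the traces of the complex derivatives vanish: trace(Dξ(w)) = 0 and trace(Dη(w)) = 0 (i.e., ξ and η have divergence zero with respect to the standard volume form). Define the Lie bracket [ξ,η](w) = Dη(w)(ξ(w)) − Dξ(w)(η(w)). Then for every w ∈ U and all vectors v₁, …, v_{n−1} ∈ ℂⁿ one has det([ξ,η](w), v₁, …, v_{n−1}) = Σ_{i=1}^{n−1} (−1)^{i+1} · D_{v_i}[ w' ↦ det(η(w'), ξ(w'), v₁, …, v_{i−1}, v_{i+1}, …, v_{n−1}) ](w), where D_{v} denotes the directional derivative at w in direction v. (This is the identity ι_{[ξ,η]}ω = d(ι_ξ ι_η ω) for the standard volume form ω = dz₁ ∧ … ∧ dzₙ, with the exterior derivative written out on constant vector fields.) -/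
open scoped BigOperators

/-- Determinant of the `n × n` complex matrix whose columns are `c 0, …, c (n-1)`. -/
noncomputable def colDet {n : ℕ} (c : Fin n → (Fin n → ℂ)) : ℂ :=
  Matrix.det (Matrix.of fun i j => c j i)


theorem colDet_eq {n : ℕ} (c : Fin n → (Fin n → ℂ)) :
    colDet c = (Matrix.detRowAlternating : (Fin n → ℂ) [⋀^Fin n]→ₗ[ℂ] ℂ) c := by
  unfold colDet
  rw [← Matrix.det_transpose]
  rfl

theorem colDet_trace {n : ℕ} (A : (Fin n → ℂ) →ₗ[ℂ] (Fin n → ℂ)) (c : Fin n → (Fin n → ℂ)) :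
    ∑ k, colDet (Function.update c k (A (c k))) = LinearMap.trace ℂ _ A * colDet c := by
  set M : Matrix (Fin n) (Fin n) ℂ := Matrix.of fun i j => c j i with hM
  have h1 : ∀ k, colDet (Function.update c k (A (c k))) =
      (M.adjugate * (LinearMap.toMatrix' A * M)) k k := by
    intro k
    have h2 : colDet (Function.update c k (A (c k))) = (M.updateCol k (A (c k))).det := by
      unfold colDet
      congr 1
      ext i j
      by_cases h : j = k
      · subst h; simp
      · simp [h, hM]
    rw [h2, ← Matrix.cramer_apply, Matrix.cramer_eq_adjugate_mulVec]
    have h3 : A (c k) = fun i => (LinearMap.toMatrix' A * M) i k := by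
      rw [← LinearMap.toMatrix'_mulVec]
      rfl
    rw [h3]
    rfl
  simp_rw [h1]
  change Matrix.trace (M.adjugate * (LinearMap.toMatrix' A * M)) = _
  rw [Matrix.trace_mul_comm, Matrix.mul_assoc, Matrix.mul_adjugate,
    LinearMap.trace_eq_matrix_trace ℂ (Pi.basisFun ℂ (Fin n)) A]
  simp [mul_comm, colDet, hM, LinearMap.toMatrix_eq_toMatrix']

theorem colDet_move {m : ℕ} (x y : Fin (m + 2) → ℂ) (v : Fin (m + 1) → (Fin (m + 2) → ℂ))
    (i : Fin (m + 1)) :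
    colDet (Fin.cons x (Function.update v i y)) =
      (-1 : ℂ) ^ (i : ℕ) * colDet (Fin.cons x (Fin.cons y (fun j : Fin m => v (i.succAbove j)))) := by
  rw [colDet_eq, colDet_eq]
  have := ((Matrix.detRowAlternating : (Fin (m+2) → ℂ) [⋀^Fin (m+2)]→ₗ[ℂ] ℂ).curryLeft x).map_insertNth
    i y (i.removeNth v)
  rw [Fin.insertNth_removeNth] at this
  simp only [AlternatingMap.curryLeft_apply_apply] at this
  refine this.trans ?_
  rw [zsmul_eq_mul]
  push_cast
  rfl

theorem colDet_swap {m : ℕ} (x y : Fin (m + 2) → ℂ) (u : Fin m → (Fin (m + 2) → ℂ)) :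
    colDet (Fin.cons x (Fin.cons y u)) = - colDet (Fin.cons y (Fin.cons x u)) := by
  rw [colDet_eq, colDet_eq]
  rw [← AlternatingMap.map_swap _ _ (show (0 : Fin (m+2)) ≠ 1 by simp)]
  congr 1
  funext j
  refine Fin.cases ?_ (fun j => ?_) j
  · simp
  · refine Fin.cases ?_ (fun j => ?_) j
    · simp
    · have h1 : (j.succ.succ : Fin (m+2)) ≠ 0 := Fin.succ_ne_zero _
      have h2 : (j.succ.succ : Fin (m+2)) ≠ 1 := by
        intro h
        exact Fin.succ_ne_zero j (Fin.succ_injective _ h)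
      simp only [Function.comp, Equiv.swap_apply_of_ne_of_ne h1 h2, Fin.cons_succ]

theorem colDet_add_left {n : ℕ} (x y : Fin (n + 1) → ℂ) (u : Fin n → (Fin (n + 1) → ℂ)) :
    colDet (Fin.cons (x + y) u) = colDet (Fin.cons x u) + colDet (Fin.cons y u) := by
  simp only [colDet_eq]
  exact AlternatingMap.map_vecCons_add _ u x y

theorem colDet_smul_left {n : ℕ} (a : ℂ) (x : Fin (n + 1) → ℂ) (u : Fin n → (Fin (n + 1) → ℂ)) :
    colDet (Fin.cons (a • x) u) = a • colDet (Fin.cons x u) := by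
  simp only [colDet_eq]
  exact AlternatingMap.map_vecCons_smul _ u a x

noncomputable def colBil {m : ℕ} (u : Fin m → (Fin (m + 2) → ℂ)) :
    (Fin (m + 2) → ℂ) →ₗ[ℂ] (Fin (m + 2) → ℂ) →ₗ[ℂ] ℂ :=
  LinearMap.mk₂ ℂ (fun x y => colDet (Fin.cons x (Fin.cons y u)))
    (fun _ _ _ => colDet_add_left _ _ _)
    (fun _ _ _ => colDet_smul_left _ _ _)
    (fun x y z => by
      rw [colDet_swap, colDet_add_left, colDet_swap x y, colDet_swap x z]; ring)
    (fun a x y => by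
      rw [colDet_swap, colDet_smul_left, colDet_swap x y, smul_neg])

theorem fderiv_colDet {m : ℕ} (u : Fin m → (Fin (m + 2) → ℂ))
    (ξ η : (Fin (m + 2) → ℂ) → (Fin (m + 2) → ℂ)) (w z : Fin (m + 2) → ℂ)
    (hξ : DifferentiableAt ℂ ξ w) (hη : DifferentiableAt ℂ η w) :
    fderiv ℂ (fun w' => colDet (Fin.cons (η w') (Fin.cons (ξ w') u))) w z =
      colDet (Fin.cons (fderiv ℂ η w z) (Fin.cons (ξ w) u)) +
      colDet (Fin.cons (η w) (Fin.cons (fderiv ℂ ξ w z) u)) := by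
  have h := (colBil u).toContinuousBilinearMap.fderiv_of_bilinear hη hξ
  have h' := congrArg (fun L => L z) h
  refine Eq.trans h' ?_
  exact add_comm _ _

theorem colDet_div {m : ℕ} (A : (Fin (m + 2) → ℂ) →ₗ[ℂ] (Fin (m + 2) → ℂ))
    (hA : LinearMap.trace ℂ _ A = 0) (x : Fin (m + 2) → ℂ)
    (v : Fin (m + 1) → (Fin (m + 2) → ℂ)) :
    colDet (Fin.cons (A x) v) + ∑ i : Fin (m + 1), (-1 : ℂ) ^ (i : ℕ) *
      colDet (Fin.cons x (Fin.cons (A (v i)) (fun j : Fin m => v (i.succAbove j)))) = 0 := by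
  have h := colDet_trace A (Fin.cons x v : Fin (m + 2) → (Fin (m + 2) → ℂ))
  rw [hA, zero_mul, Fin.sum_univ_succ] at h
  simp only [Fin.cons_zero, Fin.cons_succ, Fin.update_cons_zero, ← Fin.cons_update,
    colDet_move] at h
  exact h

/-- Coordinate form of `ι_{[ξ,η]} ω = d (ι_ξ ι_η ω)` for the standard volume form
`ω = dz₁ ∧ … ∧ dzₙ` on `ℂⁿ` (here `n = m + 2 ≥ 2`) and holomorphic divergence-free
vector fields `ξ`, `η` on an open set `U ⊆ ℂⁿ`. -/
theorem stmt0 (m : ℕ) (U : Set (Fin (m + 2) → ℂ)) (hU : IsOpen U)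
    (ξ η : (Fin (m + 2) → ℂ) → (Fin (m + 2) → ℂ))
    (hξ : ∀ w ∈ U, DifferentiableAt ℂ ξ w)
    (hη : ∀ w ∈ U, DifferentiableAt ℂ η w)
    (hdivξ : ∀ w ∈ U,
      LinearMap.trace ℂ (Fin (m + 2) → ℂ) (fderiv ℂ ξ w).toLinearMap = 0)
    (hdivη : ∀ w ∈ U,
      LinearMap.trace ℂ (Fin (m + 2) → ℂ) (fderiv ℂ η w).toLinearMap = 0)
    (w : Fin (m + 2) → ℂ) (hw : w ∈ U) (v : Fin (m + 1) → (Fin (m + 2) → ℂ)) :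
    colDet (Fin.cons (fderiv ℂ η w (ξ w) - fderiv ℂ ξ w (η w)) v) =
      ∑ i : Fin (m + 1), (-1 : ℂ) ^ (i : ℕ) *
        fderiv ℂ (fun w' => colDet (Fin.cons (η w')
          (Fin.cons (ξ w') (fun j : Fin m => v (i.succAbove j))))) w (v i) := by
  have h1 := colDet_div _ (hdivη w hw) (ξ w) v
  have h2 := colDet_div _ (hdivξ w hw) (η w) v
  simp only [ContinuousLinearMap.coe_coe] at h1 h2
  have h3 : ∀ i : Fin (m + 1), (-1 : ℂ) ^ (i : ℕ) *
        fderiv ℂ (fun w' => colDet (Fin.cons (η w')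
          (Fin.cons (ξ w') (fun j : Fin m => v (i.succAbove j))))) w (v i) =
      (-1 : ℂ) ^ (i : ℕ) * colDet (Fin.cons (η w) (Fin.cons (fderiv ℂ ξ w (v i))
        (fun j : Fin m => v (i.succAbove j)))) -
      (-1 : ℂ) ^ (i : ℕ) * colDet (Fin.cons (ξ w) (Fin.cons (fderiv ℂ η w (v i))
        (fun j : Fin m => v (i.succAbove j)))) := by
    intro i
    rw [fderiv_colDet _ ξ η w (v i) (hξ w hw) (hη w hw), colDet_swap (fderiv ℂ η w (v i))]
    ring
  rw [Finset.sum_congr rfl (fun i _ => h3 i), Finset.sum_sub_distrib]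
  have h4 := colDet_add_left (fderiv ℂ η w (ξ w) - fderiv ℂ ξ w (η w)) (fderiv ℂ ξ w (η w)) v
  rw [sub_add_cancel] at h4
  linear_combination h1 - h2 - h4
end

section
/- Let p, q ∈ ℂ[t] be nonconstant polynomials with p(0) = q(0) = 0 such that 1 − p and 1 − q have only simple roots. Let F = p(x) + q(y) + x·y·z − 1 ∈ ℂ[x,y,z] and A = ℂ[x,y,z]/(F). Then the residues modulo (F) of the monomials x^i y^j z^k with i, j, k ≥ 0 and i·j·k = 0 (i.e., the monomials 1, x^i, y^i, z^i, x^i y^j, x^i z^j, y^i z^j with i, j ≥ 1) form a basis of A as a ℂ-vector space. Equivalently, every element of A can be written uniquely in the form a₀ + Σ a_i x^i + Σ b_i y^i + Σ c_i z^i + Σ a_{ij} x^i y^j + Σ b_{ij} x^i z^j + Σ c_{ij} y^i z^j (finite sums, complex coefficients). -/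
open MvPolynomial

/-- The polynomial `F = p(x) + q(y) + x·y·z − 1` in `ℂ[x,y,z]`. -/
noncomputable def Fpoly (p q : Polynomial ℂ) : MvPolynomial (Fin 3) ℂ :=
  Polynomial.aeval (X 0) p + Polynomial.aeval (X 1) q + X 0 * X 1 * X 2 - 1

/-- The coordinate ring `A = ℂ[x,y,z]/(F)` of the surface `p(x) + q(y) + xyz = 1`. -/
abbrev SurfRing (p q : Polynomial ℂ) : Type :=
  MvPolynomial (Fin 3) ℂ ⧸ Ideal.span {Fpoly p q}

open scoped MonomialOrder in
theorem aux_order : ∃ m : MonomialOrder.{0, 0} (Fin 3),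
    ∀ a b : Fin 3 →₀ ℕ, a 2 < b 2 → a ≺[m] b := by
  have key : ∀ j : Fin 3, ¬ (2 : Fin 3) < j := by decide
  let L : LinearOrder (Fin 3) := inferInstanceAs (LinearOrder (Fin 3)ᵒᵈ)
  have W : @WellFoundedGT (Fin 3) L.toLT := inferInstanceAs (WellFoundedGT (Fin 3)ᵒᵈ)
  refine ⟨@MonomialOrder.lex (Fin 3) L W, fun a b h => ?_⟩
  refine ⟨2, ?_, h⟩
  intro j hj
  exact absurd hj (key j)

theorem aux_coeff (p : Polynomial ℂ) (i : Fin 3) (hi : i ≠ 2) (v : Fin 3 →₀ ℕ) (hv : v 2 ≠ 0) :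
    coeff v (Polynomial.aeval (X i : MvPolynomial (Fin 3) ℂ) p) = 0 := by
  classical
  rw [Polynomial.aeval_eq_sum_range, coeff_sum]
  refine Finset.sum_eq_zero fun n _ => ?_
  rw [coeff_smul, coeff_X_pow, if_neg, smul_zero]
  rintro rfl
  simp [hi] at hv

open scoped MonomialOrder in
theorem aux_F (p q : Polynomial ℂ) : ∃ m : MonomialOrder.{0, 0} (Fin 3),
    m.Monic (Fpoly p q) ∧ ∀ v : Fin 3 →₀ ℕ, m.degree (Fpoly p q) ≤ v ↔ v 0 * v 1 * v 2 ≠ 0 := by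
  classical
  obtain ⟨m, hm⟩ := aux_order
  refine ⟨m, ?_⟩
  set d : Fin 3 →₀ ℕ := Finsupp.single 0 1 + Finsupp.single 1 1 + Finsupp.single 2 1 with hd
  have hd2 : d 2 = 1 := by simp [hd]
  have hF : Fpoly p q = monomial d 1 +
      (Polynomial.aeval (X 0) p + Polynomial.aeval (X 1) q - 1) := by
    have : (monomial d (1 : ℂ)) = X 0 * X 1 * X 2 := by
      simp [hd, X, monomial_mul]
    rw [this, Fpoly]; ring
  have hdeg : m.degree (monomial d (1 : ℂ)) = d := by simp [m.degree_monomial]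
  have hlt : m.degree (Polynomial.aeval (X 0) p + Polynomial.aeval (X 1) q - 1 :
      MvPolynomial (Fin 3) ℂ) ≺[m] m.degree (monomial d (1 : ℂ)) := by
    rw [hdeg, m.degree_lt_iff (hm _ _ (by simp [hd2]))]
    intro c hc
    apply hm
    rw [hd2, Nat.lt_one_iff]
    by_contra h
    rw [mem_support_iff, coeff_sub, coeff_add, aux_coeff p 0 (by decide) c h,
      aux_coeff q 1 (by decide) c h, coeff_one, if_neg] at hc
    · simp at hc
    · rintro rfl
      simp at h
  rw [hF]
  refine ⟨m.monic_monomial_one.add_of_lt hlt, fun v => ?_⟩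
  rw [m.degree_add_of_lt hlt, hdeg, Finsupp.le_def, Fin.forall_fin_succ, Fin.forall_fin_succ,
    Fin.forall_fin_succ]
  simp [hd, Nat.one_le_iff_ne_zero, and_assoc]

/-- The residues of the monomials `x^i y^j z^k` with `i·j·k = 0` form a `ℂ`-basis of
`A = ℂ[x,y,z]/(p(x) + q(y) + xyz − 1)`. -/
theorem stmt4 (p q : Polynomial ℂ) (hp : 0 < p.natDegree) (hq : 0 < q.natDegree)
    (hp0 : p.eval 0 = 0) (hq0 : q.eval 0 = 0)
    (hps : Squarefree (1 - p)) (hqs : Squarefree (1 - q)) :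
    LinearIndependent ℂ
      (fun v : {v : Fin 3 →₀ ℕ // v 0 * v 1 * v 2 = 0} =>
        Ideal.Quotient.mk (Ideal.span {Fpoly p q}) (monomial v.1 (1 : ℂ))) ∧
    Submodule.span ℂ
      (Set.range (fun v : {v : Fin 3 →₀ ℕ // v 0 * v 1 * v 2 = 0} =>
        Ideal.Quotient.mk (Ideal.span {Fpoly p q}) (monomial v.1 (1 : ℂ)))) = ⊤ := by
  classical
  obtain ⟨m, hmon, hle⟩ := aux_F p q
  have hmk : ∀ (c : ℂ) (f : MvPolynomial (Fin 3) ℂ),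
      Ideal.Quotient.mk (Ideal.span {Fpoly p q}) (c • f) =
        c • Ideal.Quotient.mk (Ideal.span {Fpoly p q}) f := fun _ _ => rfl
  constructor
  · rw [linearIndependent_iff']
    intro s g hg i hi
    simp only [← hmk, ← map_sum] at hg
    rw [Ideal.Quotient.eq_zero_iff_mem, Ideal.mem_span_singleton] at hg
    obtain ⟨h, hh⟩ := hg
    have hc : ∀ v, coeff v (∑ i ∈ s, g i • monomial i.1 (1 : ℂ)) =
        ∑ i ∈ s, if i.1 = v then g i else 0 := by
      intro v
      simp [coeff_sum, coeff_monomial]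
    have h0 : (∑ i ∈ s, g i • monomial i.1 (1 : ℂ)) = 0 := by
      by_contra hne
      have hdeg := m.coeff_degree_ne_zero_iff.2 hne
      rw [hc] at hdeg
      obtain ⟨v, -, hv⟩ := Finset.exists_ne_zero_of_sum_ne_zero hdeg
      have hv' : v.1 = m.degree (∑ i ∈ s, g i • monomial i.1 (1 : ℂ)) := by
        by_contra hn
        exact hv (if_neg hn)
      refine (hle v.1).1 ?_ v.2
      rw [hv', hh, m.degree_mul' (hh ▸ hne)]
      exact le_self_add
    have := hc i.1
    rw [h0, coeff_zero] at this
    simp only [Subtype.coe_inj, Finset.sum_ite_eq', hi, if_true] at this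
    exact this.symm
  · rw [eq_top_iff]
    rintro a -
    obtain ⟨f, rfl⟩ := Ideal.Quotient.mk_surjective a
    obtain ⟨g, r, hf, -, hr⟩ := m.div_single (b := Fpoly p q)
      (by rw [hmon.leadingCoeff_eq_one]; exact isUnit_one) f
    have : Ideal.Quotient.mk (Ideal.span {Fpoly p q}) f =
        Ideal.Quotient.mk (Ideal.span {Fpoly p q}) r := by
      rw [Ideal.Quotient.eq, hf, add_sub_cancel_right]
      exact Ideal.mul_mem_left _ _ (Ideal.mem_span_singleton_self _)
    rw [this, r.as_sum, map_sum]
    refine Submodule.sum_mem _ fun v hv => ?_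
    have hv0 : v 0 * v 1 * v 2 = 0 := by
      by_contra hn
      exact hr v hv ((hle v).2 hn)
    have : monomial v (coeff v r) = coeff v r • monomial v (1 : ℂ) := by
      simp [smul_monomial]
    rw [this, hmk]
    exact Submodule.smul_mem _ _ (Submodule.subset_span ⟨⟨v, hv0⟩, rfl⟩)
end

section
/- Let p, q ∈ ℂ[t] be nonconstant polynomials with p(0) = q(0) = 0 such that 1 − p and 1 − q have only simple roots. Let F = p(x) + q(y) + x·y·z − 1 and A = ℂ[x,y,z]/(F). Let D_z be the ℂ-derivation of ℂ[x,y,z] determined by D_z(x) = q'(y) + x·z, D_z(y) = −(p'(x) + y·z), D_z(z) = 0. Then D_z(F) = 0, so D_z induces a ℂ-derivation δ_z of A; and the kernel of δ_z equals the ℂ-subalgebra of A generated by the residue of z (the image of ℂ[z] in A). -/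
open MvPolynomial

/-- The derivation `D_z = (q'(y) + xz) ∂/∂x − (p'(x) + yz) ∂/∂y` of `ℂ[x,y,z]`. -/
noncomputable def Dz (p q : Polynomial ℂ) :
    Derivation ℂ (MvPolynomial (Fin 3) ℂ) (MvPolynomial (Fin 3) ℂ) :=
  mkDerivation ℂ
    ![Polynomial.aeval (X 1) (Polynomial.derivative q) + X 0 * X 2,
      -(Polynomial.aeval (X 0) (Polynomial.derivative p) + X 1 * X 2),
      0]

namespace Aux

/-- The coefficientwise derivative on `ℂ[y][x]`. -/
noncomputable def Dy (G : Polynomial (Polynomial ℂ)) : Polynomial (Polynomial ℂ) :=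
  ∑ n ∈ G.support, Polynomial.monomial n (Polynomial.derivative (G.coeff n))

lemma coeff_Dy (G : Polynomial (Polynomial ℂ)) (n : ℕ) :
    (Dy G).coeff n = Polynomial.derivative (G.coeff n) := by
  simp only [Dy, Polynomial.finsetSum_coeff, Polynomial.coeff_monomial]
  rw [Finset.sum_ite_eq']
  split_ifs with h
  · rfl
  · rw [Polynomial.notMem_support_iff.1 h]; simp

lemma Dy_add (G H : Polynomial (Polynomial ℂ)) : Dy (G + H) = Dy G + Dy H := by
  ext1 n; simp [coeff_Dy]

lemma Dy_monomial (n : ℕ) (c : Polynomial ℂ) :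
    Dy (Polynomial.monomial n c) = Polynomial.monomial n (Polynomial.derivative c) := by
  ext1 k; simp only [coeff_Dy, Polynomial.coeff_monomial]; split_ifs <;> simp

/-- `u = 1 - p(x) - q(y)` -/
noncomputable def U (p q : Polynomial ℂ) : Polynomial (Polynomial ℂ) :=
  1 - p.map Polynomial.C - Polynomial.C q

/-- The kernel equation. -/
def Eqn (p q : Polynomial ℂ) (N : ℕ) (G : Polynomial (Polynomial ℂ)) : Prop :=
  (Polynomial.X * Polynomial.derivative G - (N : Polynomial (Polynomial ℂ)) * G) *
    (Polynomial.C (Polynomial.X * Polynomial.derivative q) + U p q) =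
  (Polynomial.C Polynomial.X * Dy G - (N : Polynomial (Polynomial ℂ)) * G) *
    (Polynomial.X * (Polynomial.derivative p).map Polynomial.C + U p q)

lemma one_dim (g u : Polynomial ℂ) (N : ℕ) (hg : g.coeff 0 = 0) (hu : u.coeff 0 ≠ 0)
    (h : (N : Polynomial ℂ) * g * Polynomial.derivative u = Polynomial.derivative g * u) :
    g = 0 := by
  by_contra hne
  obtain ⟨H, hH, hH0⟩ := Polynomial.exists_eq_pow_rootMultiplicity_mul_and_not_dvd g hne 0
  set k := g.rootMultiplicity 0 with hk
  simp only [map_zero, sub_zero] at hH hH0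
  rw [Polynomial.X_dvd_iff] at hH0
  have hk0 : k ≠ 0 := by
    intro h0
    rw [h0, pow_zero, one_mul] at hH
    exact hH0 (hH ▸ hg)
  obtain ⟨j, hj⟩ := Nat.exists_eq_succ_of_ne_zero hk0
  rw [hj] at hH
  rw [hH, Polynomial.derivative_mul, Polynomial.derivative_X_pow] at h
  have h2 : (Polynomial.X : Polynomial ℂ) ^ j *
      ((N : Polynomial ℂ) * Polynomial.X * H * Polynomial.derivative u) =
      Polynomial.X ^ j * ((Polynomial.C ((j + 1 : ℕ) : ℂ) * H +
        Polynomial.X * Polynomial.derivative H) * u) := by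
    simp only [Nat.succ_eq_add_one, Nat.add_sub_cancel] at h
    linear_combination h
  have h3 := mul_left_cancel₀ (pow_ne_zero j Polynomial.X_ne_zero) h2
  have h4 := congrArg (Polynomial.eval 0) h3
  simp only [Polynomial.eval_mul, Polynomial.eval_add, Polynomial.eval_X, Polynomial.eval_C,
    ← Polynomial.coeff_zero_eq_eval_zero, mul_zero, zero_mul, add_zero] at h4
  have : ((j + 1 : ℕ) : ℂ) ≠ 0 := by exact_mod_cast Nat.succ_ne_zero j
  exact mul_ne_zero (mul_ne_zero this hH0) hu h4.symm

lemma lem1 (p q : Polynomial ℂ) (hp0 : p.eval 0 = 0) (hq0 : q.eval 0 = 0) (N : ℕ)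
    (G : Polynomial (Polynomial ℂ)) (h : Eqn p q N G) (h0 : (G.coeff 0).coeff 0 = 0) :
    ∃ G', G = Polynomial.X * Polynomial.C Polynomial.X * G' := by
  rw [← Polynomial.coeff_zero_eq_eval_zero] at hp0 hq0
  have hx : G.coeff 0 = 0 := by
    apply one_dim _ (1 - q) N h0 (by simp [hq0])
    have h1 := congrArg (fun P => Polynomial.coeff P 0) h
    simp only [Polynomial.mul_coeff_zero, Polynomial.coeff_add, Polynomial.coeff_sub, U,
      Polynomial.coeff_X_zero, Polynomial.coeff_C_zero, Polynomial.coeff_map, hp0, coeff_Dy,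
      Polynomial.coeff_one_zero, Polynomial.coeff_natCast_ite, if_true, map_zero] at h1
    apply mul_left_cancel₀ (Polynomial.X_ne_zero (R := ℂ))
    simp only [Polynomial.derivative_sub, Polynomial.derivative_one]
    linear_combination h1
  have hy : G.map (Polynomial.evalRingHom 0) = 0 := by
    apply one_dim _ (1 - p) N (by simpa [← Polynomial.coeff_zero_eq_eval_zero] using h0)
      (by simp [hp0])
    have h1 := congrArg (Polynomial.map (Polynomial.evalRingHom 0)) h
    have hc : (Polynomial.evalRingHom (0 : ℂ)).comp Polynomial.C = RingHom.id ℂ := by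
      ext; simp
    simp only [Polynomial.map_mul, Polynomial.map_add, Polynomial.map_sub, U, Polynomial.map_X,
      Polynomial.map_C, Polynomial.map_natCast, Polynomial.map_map, hc, Polynomial.map_id,
      Polynomial.map_one, ← Polynomial.derivative_map, map_mul, Polynomial.coe_evalRingHom,
      Polynomial.eval_X, Polynomial.eval_mul, zero_mul, ← Polynomial.coeff_zero_eq_eval_zero, hq0,
      map_zero] at h1
    apply mul_left_cancel₀ (Polynomial.X_ne_zero (R := ℂ))
    simp only [Polynomial.derivative_sub, Polynomial.derivative_one]
    linear_combination -h1
  obtain ⟨G1, rfl⟩ := Polynomial.X_dvd_iff.2 hx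
  rw [Polynomial.map_mul, Polynomial.map_X, mul_eq_zero, or_iff_right Polynomial.X_ne_zero] at hy
  have : Polynomial.C Polynomial.X ∣ G1 := by
    rw [Polynomial.C_dvd_iff_dvd_coeff]
    intro i
    rw [Polynomial.X_dvd_iff]
    have := congrArg (fun P => Polynomial.coeff P i) hy
    simpa [← Polynomial.coeff_zero_eq_eval_zero] using this
  obtain ⟨G2, rfl⟩ := this
  exact ⟨G2, by ring⟩

lemma lem2 (p q : Polynomial ℂ) (hp : 0 < p.natDegree) (hp0 : p.eval 0 = 0) (hq0 : q.eval 0 = 0)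
    (G : Polynomial (Polynomial ℂ)) (h : Eqn p q 0 G) (h0 : (G.coeff 0).coeff 0 = 0) :
    G = 0 := by
  obtain ⟨G', hG'⟩ := lem1 p q hp0 hq0 0 G h h0
  by_contra hne
  have hx : G.coeff 0 = 0 := by rw [hG']; simp
  have ha : G.natDegree ≠ 0 := by
    intro hd
    apply hne
    rw [Polynomial.eq_C_of_natDegree_eq_zero hd, hx, map_zero]
  obtain ⟨a, had⟩ : ∃ a, G.natDegree = a + 1 := Nat.exists_eq_succ_of_ne_zero ha
  obtain ⟨m, hm⟩ : ∃ m, p.natDegree = m + 1 := Nat.exists_eq_succ_of_ne_zero hp.ne'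
  have hU : (U p q).natDegree ≤ m + 1 := by
    unfold U
    have e1 : (1 - p.map (Polynomial.C : ℂ →+* Polynomial ℂ)).natDegree ≤ m + 1 := by
      refine (Polynomial.natDegree_sub_le _ _).trans (max_le (by simp) ?_)
      exact (Polynomial.natDegree_map_le).trans hm.le
    refine (Polynomial.natDegree_sub_le _ _).trans (max_le e1 ?_)
    exact (Polynomial.natDegree_C _).le.trans (Nat.zero_le _)
  have d1 : (Polynomial.X * Polynomial.derivative G).natDegree ≤ a + 1 := by
    refine Polynomial.natDegree_mul_le.trans ?_
    have := Polynomial.natDegree_derivative_le G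
    rw [Polynomial.natDegree_X]; omega
  have d2 : (Polynomial.C (Polynomial.X * Polynomial.derivative q) + U p q).natDegree ≤ m + 1 :=
    Polynomial.natDegree_add_le_of_degree_le ((Polynomial.natDegree_C _).le.trans (Nat.zero_le _)) hU
  have d3 : (Polynomial.C Polynomial.X * Dy G).natDegree ≤ a + 1 := by
    refine (Polynomial.natDegree_C_mul_le _ _).trans ?_
    rw [Polynomial.natDegree_le_iff_coeff_eq_zero]
    intro i hi
    rw [coeff_Dy, Polynomial.coeff_eq_zero_of_natDegree_lt (by omega), Polynomial.derivative_zero]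
  have d4 : (Polynomial.X * (Polynomial.derivative p).map Polynomial.C + U p q).natDegree
      ≤ m + 1 := by
    refine Polynomial.natDegree_add_le_of_degree_le (Polynomial.natDegree_mul_le.trans ?_) hU
    have := Polynomial.natDegree_derivative_le p
    have := Polynomial.natDegree_map_le (f := (Polynomial.C : ℂ →+* _)) (p := Polynomial.derivative p)
    rw [Polynomial.natDegree_X]; omega
  unfold Eqn at h
  rw [Nat.cast_zero, zero_mul, sub_zero, sub_zero] at h
  have h1 := congrArg (fun P => Polynomial.coeff P ((a + 1) + (m + 1))) h
  simp only [Polynomial.coeff_mul_add_eq_of_natDegree_le d1 d2,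
    Polynomial.coeff_mul_add_eq_of_natDegree_le d3 d4] at h1
  simp only [U, Polynomial.coeff_add, Polynomial.coeff_sub, Polynomial.coeff_X_mul,
    Polynomial.coeff_C_mul, coeff_Dy, Polynomial.coeff_map, Polynomial.coeff_derivative,
    Polynomial.coeff_C_succ, Polynomial.coeff_one, Nat.succ_ne_zero, if_false] at h1
  set g := G.coeff (a + 1) with hg
  have hg0 : g ≠ 0 := by
    rw [hg, ← had]; exact Polynomial.leadingCoeff_ne_zero.2 hne
  set c := p.coeff (m + 1) with hc
  have hc0 : c ≠ 0 := by
    rw [hc, ← hm]; apply Polynomial.leadingCoeff_ne_zero.2; rintro rfl; simp at hp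
  have h2 : Polynomial.C c * (Polynomial.C ((a : ℂ) + 1) * g +
      Polynomial.C (m : ℂ) * (Polynomial.X * Polynomial.derivative g)) = 0 := by
    simp only [map_mul, map_add, map_one, map_natCast] at h1 ⊢
    linear_combination -h1
  rw [mul_eq_zero, or_iff_right (by simpa using hc0)] at h2
  have h3 := congrArg (fun P => Polynomial.coeff P g.natDegree) h2
  simp only [Polynomial.coeff_add, Polynomial.coeff_C_mul, Polynomial.coeff_zero] at h3
  have h4 : (Polynomial.X * Polynomial.derivative g).coeff g.natDegree
      = g.natDegree * g.coeff g.natDegree := by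
    rcases hn : g.natDegree with _ | b
    · simp
    · rw [Polynomial.coeff_X_mul, Polynomial.coeff_derivative]; push_cast; ring
  rw [h4] at h3
  have h5 : ((a + 1 + m * g.natDegree : ℕ) : ℂ) * g.coeff g.natDegree = 0 := by
    push_cast; linear_combination h3
  rw [mul_eq_zero] at h5
  rcases h5 with h5 | h5
  · rw [Nat.cast_eq_zero] at h5; omega
  · exact hg0 (Polynomial.leadingCoeff_eq_zero.1 h5)

/-- Evaluation `ℂ[y][x] → ℂ[x,y,z]`. -/
noncomputable def phi0 : Polynomial (Polynomial ℂ) →+* MvPolynomial (Fin 3) ℂ :=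
  Polynomial.eval₂RingHom
    (Polynomial.aeval (X 1 : MvPolynomial (Fin 3) ℂ) : Polynomial ℂ →ₐ[ℂ] _).toRingHom (X 0)

lemma phi0_X : phi0 Polynomial.X = X 0 := by simp [phi0]

lemma phi0_C (c : Polynomial ℂ) : phi0 (Polynomial.C c) = Polynomial.aeval (X 1) c := by
  simp [phi0]

lemma phi0_mapC (c : Polynomial ℂ) :
    phi0 (c.map Polynomial.C) = Polynomial.aeval (X 0) c := by
  simp [phi0, Polynomial.eval₂_map, Polynomial.aeval_def]
  congr 1
  ext; simp

lemma Dz_x (p q : Polynomial ℂ) : Dz p q (X 0) =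
    Polynomial.aeval (X 1) (Polynomial.derivative q) + X 0 * X 2 := by
  simp [Dz, mkDerivation_X]

lemma Dz_y (p q : Polynomial ℂ) : Dz p q (X 1) =
    -(Polynomial.aeval (X 0) (Polynomial.derivative p) + X 1 * X 2) := by
  simp [Dz, mkDerivation_X]

lemma Dz_z (p q : Polynomial ℂ) : Dz p q (X 2) = 0 := by
  simp [Dz, mkDerivation_X]

lemma Dz_phi0 (p q : Polynomial ℂ) (G : Polynomial (Polynomial ℂ)) :
    Dz p q (phi0 G) = phi0 (Polynomial.derivative G) * Dz p q (X 0) +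
      phi0 (Dy G) * Dz p q (X 1) := by
  induction G using Polynomial.induction_on' with
  | add G H hG hH => simp only [map_add, Dy_add, hG, hH]; ring
  | monomial n c =>
    rw [Dy_monomial, Polynomial.derivative_monomial]
    simp only [← Polynomial.C_mul_X_pow_eq_monomial, map_mul, map_pow, phi0_C, phi0_X,
      Derivation.leibniz, Derivation.map_aeval, Derivation.leibniz_pow, smul_eq_mul, map_natCast,
      nsmul_eq_mul]
    ring

lemma Dz_F (p q : Polynomial ℂ) : Dz p q (Fpoly p q) = 0 := by
  simp only [Fpoly, map_sub, map_add, Derivation.map_aeval, Derivation.leibniz, smul_eq_mul,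
    Dz_x, Dz_y, Dz_z, Derivation.map_one_eq_zero]
  ring

/-- The composite `ℂ[y][x] → A`. -/
noncomputable def phi (p q : Polynomial ℂ) : Polynomial (Polynomial ℂ) →+* SurfRing p q :=
  (Ideal.Quotient.mk (Ideal.span {Fpoly p q})).comp phi0

lemma phi_inj (p q : Polynomial ℂ) : Function.Injective (phi p q) := by
  let K := FractionRing (Polynomial (Polynomial ℂ))
  let i : Polynomial (Polynomial ℂ) →+* K := algebraMap _ _
  have hi : Function.Injective i := IsFractionRing.injective _ _
  let x : K := i Polynomial.X
  let y : K := i (Polynomial.C Polynomial.X)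
  have hx : x ≠ 0 := by
    intro h; exact Polynomial.X_ne_zero (hi (h.trans (map_zero i).symm))
  have hy : y ≠ 0 := by
    intro h
    have := hi (h.trans (map_zero i).symm)
    simp at this
  let ψ : MvPolynomial (Fin 3) ℂ →+* K := eval₂Hom (i.comp (Polynomial.C.comp Polynomial.C))
    ![x, y, i (U p q) / (x * y)]
  have h0 : ψ (X 0) = x := by simp [ψ]
  have h1 : ψ (X 1) = y := by simp [ψ]
  have h2 : ψ (X 2) = i (U p q) / (x * y) := by simp [ψ]
  have hcomp : ψ.comp phi0 = i := by
    apply Polynomial.ringHom_ext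
    · intro c
      rw [RingHom.comp_apply, phi0_C]
      have : (ψ.comp (Polynomial.aeval (X 1 : MvPolynomial (Fin 3) ℂ) :
          Polynomial ℂ →ₐ[ℂ] _).toRingHom) = i.comp Polynomial.C := by
        apply Polynomial.ringHom_ext
        · intro r; simp [ψ, algebraMap_eq]
        · simp [h1, y]
      exact RingHom.congr_fun this c
    · rw [RingHom.comp_apply, phi0_X, h0]
  have hF : Fpoly p q = phi0 (-(U p q)) + X 0 * X 1 * X 2 := by
    simp only [U, Fpoly, map_neg, map_sub, map_one, phi0_mapC, phi0_C]; ring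
  have hψF : ψ (Fpoly p q) = 0 := by
    rw [hF, map_add, ← RingHom.comp_apply, hcomp, map_mul, map_mul, h0, h1, h2, map_neg,
      mul_div_cancel₀ _ (mul_ne_zero hx hy)]
    ring
  rw [injective_iff_map_eq_zero]
  intro G hG
  have : phi0 G ∈ Ideal.span {Fpoly p q} := Ideal.Quotient.eq_zero_iff_mem.1 hG
  obtain ⟨h, hh⟩ := Ideal.mem_span_singleton'.1 this
  have h3 : i G = 0 := by
    rw [← hcomp, RingHom.comp_apply, ← hh, map_mul, hψF, mul_zero]
  exact hi (h3.trans (map_zero i).symm)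

lemma cancelX (p q : Polynomial ℂ) (hp0 : p.eval 0 = 0) (hq0 : q.eval 0 = 0) (i : Fin 3)
    (a : SurfRing p q) (h : Ideal.Quotient.mk (Ideal.span {Fpoly p q}) (X i) * a = 0) : a = 0 := by
  obtain ⟨g, rfl⟩ := Ideal.Quotient.mk_surjective a
  rw [← map_mul, Ideal.Quotient.eq_zero_iff_mem] at h
  obtain ⟨k, hk⟩ := Ideal.mem_span_singleton'.1 h
  have hd : X i ∣ k * Fpoly p q := hk ▸ dvd_mul_right _ _
  rcases (X_prime (i := i)).dvd_or_dvd hd with h1 | h1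
  · obtain ⟨k', rfl⟩ := h1
    rw [mul_assoc] at hk
    have := mul_left_cancel₀ (X_ne_zero i) hk
    rw [Ideal.Quotient.eq_zero_iff_mem, ← this]
    exact Ideal.mul_mem_left _ _ (Ideal.mem_span_singleton_self _)
  · obtain ⟨k', hk'⟩ := h1
    exfalso
    have := congrArg (MvPolynomial.aeval (fun _ => (0 : ℂ)) : MvPolynomial (Fin 3) ℂ →ₐ[ℂ] ℂ) hk'
    simp only [Fpoly, map_sub, map_add, map_mul, map_one, MvPolynomial.aeval_X,
      ← Polynomial.aeval_algHom_apply, Polynomial.coe_aeval_eq_eval, hp0, hq0] at this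
    norm_num at this

lemma key (p q : Polynomial ℂ) (hp : 0 < p.natDegree)
    (hp0 : p.eval 0 = 0) (hq0 : q.eval 0 = 0)
    (δ : Derivation ℂ (SurfRing p q) (SurfRing p q))
    (hδ : ∀ g : MvPolynomial (Fin 3) ℂ,
        δ (Ideal.Quotient.mk (Ideal.span {Fpoly p q}) g) =
          Ideal.Quotient.mk (Ideal.span {Fpoly p q}) (Dz p q g))
    (x y z : SurfRing p q) (hx : x = Ideal.Quotient.mk (Ideal.span {Fpoly p q}) (X 0))
    (hy : y = Ideal.Quotient.mk (Ideal.span {Fpoly p q}) (X 1))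
    (hz : z = Ideal.Quotient.mk (Ideal.span {Fpoly p q}) (X 2)) (N : ℕ) :
    ∀ (a : SurfRing p q) (G : Polynomial (Polynomial ℂ)), δ a = 0 →
      (x * y) ^ N * a = phi p q G → a ∈ Algebra.adjoin ℂ {z} := by
  have hphiX : phi p q Polynomial.X = x := by rw [phi, RingHom.comp_apply, phi0_X, hx]
  have hphiY : phi p q (Polynomial.C Polynomial.X) = y := by
    rw [phi, RingHom.comp_apply, phi0_C, hy, Polynomial.aeval_X]
  have hphiU : phi p q (U p q) = x * y * z := by
    have h2 : Fpoly p q = X 0 * X 1 * X 2 - phi0 (U p q) := by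
      simp only [U, Fpoly, map_sub, map_one, phi0_mapC, phi0_C]; ring
    have h : Ideal.Quotient.mk (Ideal.span {Fpoly p q}) (X 0 * X 1 * X 2 - phi0 (U p q)) = 0 :=
      Ideal.Quotient.eq_zero_iff_mem.2 (h2 ▸ Ideal.mem_span_singleton_self _)
    rw [map_sub, map_mul, map_mul, ← hx, ← hy, ← hz, sub_eq_zero] at h
    exact h.symm
  have hphiC (c : ℂ) : phi p q (Polynomial.C (Polynomial.C c)) = algebraMap ℂ _ c := by
    rw [phi, RingHom.comp_apply, phi0_C, Polynomial.aeval_C]; rfl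
  have hδx : δ x = phi p q (Polynomial.C (Polynomial.derivative q)) + x * z := by
    rw [hx, hδ, Dz_x, hz, map_add, map_mul, phi, RingHom.comp_apply, phi0_C]
  have hδy : δ y = -(phi p q ((Polynomial.derivative p).map Polynomial.C) + y * z) := by
    rw [hy, hδ, Dz_y, hz, map_neg, map_add, map_mul, phi, RingHom.comp_apply, phi0_mapC]
  have hδz : δ z = 0 := by rw [hz, hδ, Dz_z, map_zero]
  have hδphi (G) : δ (phi p q G) = phi p q (Polynomial.derivative G) * δ x +
      phi p q (Dy G) * δ y := by
    rw [hx, hy, hδ, hδ]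
    simp only [phi, RingHom.comp_apply]
    rw [hδ, Dz_phi0, map_add, map_mul, map_mul]
  have hcan (a b : SurfRing p q) (h : x * y * a = x * y * b) : a = b := by
    rw [← sub_eq_zero]
    apply cancelX p q hp0 hq0 1
    apply cancelX p q hp0 hq0 0
    rw [← hx, ← hy]; linear_combination h
  have hEqn (N : ℕ) (a : SurfRing p q) (G) (ha : δ a = 0) (hG : (x * y) ^ N * a = phi p q G) :
      Eqn p q N G := by
    apply phi_inj p q
    have h1 : x * y * δ ((x * y) ^ N * a) = N * δ (x * y) * phi p q G := by
      rw [← hG]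
      rcases N with _ | n
      · simp [ha]
      · simp only [Derivation.leibniz, Derivation.leibniz_pow, ha, smul_eq_mul, nsmul_eq_mul,
          Nat.add_sub_cancel]
        ring
    rw [hG, hδphi, Derivation.leibniz, smul_eq_mul, smul_eq_mul, hδx, hδy] at h1
    simp only [map_mul, map_add, map_sub, map_natCast, hphiX, hphiY, hphiU]
    linear_combination h1
  have hzmem : z ∈ Algebra.adjoin ℂ {z} := Algebra.subset_adjoin rfl
  have hUc : ((U p q).coeff 0).coeff 0 = 1 := by
    simp [U, Polynomial.coeff_zero_eq_eval_zero p, Polynomial.coeff_zero_eq_eval_zero q, hp0, hq0]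
  induction N with
  | zero =>
    intro a G ha hG
    set c := (G.coeff 0).coeff 0 with hc
    have h1 : (x * y) ^ 0 * (a - algebraMap ℂ _ c) =
        phi p q (G - Polynomial.C (Polynomial.C c)) := by
      rw [map_sub, ← hG, hphiC]; ring
    have h2 : δ (a - algebraMap ℂ _ c) = 0 := by simp [ha]
    have h3 := lem2 p q hp hp0 hq0 _ (hEqn 0 _ _ h2 h1) (by simp [hc])
    rw [h3, map_zero, pow_zero, one_mul, sub_eq_zero] at h1
    rw [h1]; exact Subalgebra.algebraMap_mem _ _
  | succ N ih =>
    intro a G ha hG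
    set c := (G.coeff 0).coeff 0 with hc
    have h1 : (x * y) ^ (N + 1) * (a - algebraMap ℂ _ c * z ^ (N + 1)) =
        phi p q (G - Polynomial.C (Polynomial.C c) * U p q ^ (N + 1)) := by
      rw [map_sub, ← hG, map_mul, map_pow, hphiC, hphiU]; ring
    have h2 : δ (a - algebraMap ℂ _ c * z ^ (N + 1)) = 0 := by
      simp [ha, Derivation.leibniz_pow, hδz]
    obtain ⟨G', hG'⟩ := lem1 p q hp0 hq0 _ _ (hEqn (N + 1) _ _ h2 h1)
      (by simp [hc, Polynomial.coeff_zero_eq_eval_zero, Polynomial.eval_pow] at hUc ⊢; simp [hUc])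
    have h3 := ih (a - algebraMap ℂ _ c * z ^ (N + 1)) G' h2 (by
      apply hcan
      rw [hG', map_mul, map_mul, hphiX, hphiY] at h1
      linear_combination h1)
    have h4 := add_mem h3 (mul_mem (Subalgebra.algebraMap_mem (Algebra.adjoin ℂ {z}) c)
      (pow_mem hzmem (N + 1)))
    rwa [sub_add_cancel] at h4

lemma exists_rep (p q : Polynomial ℂ) (g : MvPolynomial (Fin 3) ℂ) :
    ∃ (N : ℕ) (G : Polynomial (Polynomial ℂ)),
      (Ideal.Quotient.mk (Ideal.span {Fpoly p q}) (X 0) *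
        Ideal.Quotient.mk (Ideal.span {Fpoly p q}) (X 1)) ^ N *
        Ideal.Quotient.mk (Ideal.span {Fpoly p q}) g = phi p q G := by
  have hphiX : phi p q Polynomial.X = Ideal.Quotient.mk (Ideal.span {Fpoly p q}) (X 0) := by
    rw [phi, RingHom.comp_apply, phi0_X]
  have hphiY : phi p q (Polynomial.C Polynomial.X) =
      Ideal.Quotient.mk (Ideal.span {Fpoly p q}) (X 1) := by
    rw [phi, RingHom.comp_apply, phi0_C, Polynomial.aeval_X]
  have hphiU : phi p q (U p q) = Ideal.Quotient.mk (Ideal.span {Fpoly p q}) (X 0) *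
      Ideal.Quotient.mk (Ideal.span {Fpoly p q}) (X 1) *
      Ideal.Quotient.mk (Ideal.span {Fpoly p q}) (X 2) := by
    have h2 : Fpoly p q = X 0 * X 1 * X 2 - phi0 (U p q) := by
      simp only [U, Fpoly, map_sub, map_one, phi0_mapC, phi0_C]; ring
    have h : Ideal.Quotient.mk (Ideal.span {Fpoly p q}) (X 0 * X 1 * X 2 - phi0 (U p q)) = 0 :=
      Ideal.Quotient.eq_zero_iff_mem.2 (h2 ▸ Ideal.mem_span_singleton_self _)
    rw [map_sub, map_mul, map_mul, sub_eq_zero] at h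
    exact h.symm
  induction g using MvPolynomial.induction_on with
  | C c =>
    refine ⟨0, Polynomial.C (Polynomial.C c), ?_⟩
    rw [pow_zero, one_mul, phi, RingHom.comp_apply, phi0_C, Polynomial.aeval_C]; rfl
  | add g h hg hh =>
    obtain ⟨N, G, hG⟩ := hg
    obtain ⟨M, H, hH⟩ := hh
    refine ⟨N + M, (Polynomial.X * Polynomial.C Polynomial.X) ^ M * G +
      (Polynomial.X * Polynomial.C Polynomial.X) ^ N * H, ?_⟩
    simp only [map_add, map_mul, map_pow, hphiX, hphiY, ← hG, ← hH]
    ring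
  | mul_X g i hg =>
    obtain ⟨N, G, hG⟩ := hg
    fin_cases i
    · refine ⟨N, G * Polynomial.X, ?_⟩
      simp only [map_mul, hphiX, ← hG, Fin.zero_eta]; ring
    · refine ⟨N, G * Polynomial.C Polynomial.X, ?_⟩
      simp only [map_mul, hphiY, ← hG, Fin.mk_one]; ring
    · refine ⟨N + 1, G * U p q, ?_⟩
      simp only [map_mul, hphiU, ← hG, Fin.reduceFinMk]; ring

end Aux

/-- `D_z` annihilates `F`, hence induces a derivation `δ_z` of `A = ℂ[x,y,z]/(F)`,
whose kernel is the `ℂ`-subalgebra generated by the residue of `z`. -/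
theorem stmt5 (p q : Polynomial ℂ) (hp : 0 < p.natDegree) (hq : 0 < q.natDegree)
    (hp0 : p.eval 0 = 0) (hq0 : q.eval 0 = 0)
    (hps : Squarefree (1 - p)) (hqs : Squarefree (1 - q)) :
    Dz p q (Fpoly p q) = 0 ∧
    ∃ δ : Derivation ℂ (SurfRing p q) (SurfRing p q),
      (∀ g : MvPolynomial (Fin 3) ℂ,
        δ (Ideal.Quotient.mk (Ideal.span {Fpoly p q}) g) =
          Ideal.Quotient.mk (Ideal.span {Fpoly p q}) (Dz p q g)) ∧
      {a : SurfRing p q | δ a = 0} =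
        (Algebra.adjoin ℂ {Ideal.Quotient.mk (Ideal.span {Fpoly p q}) (X 2)} :
          Subalgebra ℂ (SurfRing p q)) := by
  refine ⟨Aux.Dz_F p q, ?_⟩
  have hd : ∀ g, Ideal.Quotient.mkₐ ℂ (Ideal.span {Fpoly p q}) g = 0 →
      Ideal.Quotient.mkₐ ℂ (Ideal.span {Fpoly p q}) (Dz p q g) = 0 := by
    intro g hg
    obtain ⟨k, rfl⟩ := Ideal.mem_span_singleton'.1 (Ideal.Quotient.eq_zero_iff_mem.1 hg)
    apply Ideal.Quotient.eq_zero_iff_mem.2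
    rw [Derivation.leibniz, Aux.Dz_F, smul_zero, zero_add, smul_eq_mul]
    exact Ideal.mul_mem_right _ _ (Ideal.mem_span_singleton_self _)
  have hδ : ∀ g : MvPolynomial (Fin 3) ℂ,
      Derivation.liftOfSurjective (Ideal.Quotient.mkₐ_surjective ℂ (Ideal.span {Fpoly p q})) hd
        (Ideal.Quotient.mk (Ideal.span {Fpoly p q}) g) =
          Ideal.Quotient.mk (Ideal.span {Fpoly p q}) (Dz p q g) := fun g =>
    Derivation.liftOfSurjective_apply
      (Ideal.Quotient.mkₐ_surjective ℂ (Ideal.span {Fpoly p q})) hd g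
  generalize Derivation.liftOfSurjective
    (Ideal.Quotient.mkₐ_surjective ℂ (Ideal.span {Fpoly p q})) hd = δ at hδ
  refine ⟨δ, hδ, ?_⟩
  ext a
  simp only [Set.mem_ofPred_eq, SetLike.mem_coe]
  constructor
  · intro ha
    obtain ⟨g, rfl⟩ := Ideal.Quotient.mk_surjective a
    obtain ⟨N, G, hG⟩ := Aux.exists_rep p q g
    exact Aux.key p q hp hp0 hq0 δ hδ _ _ _ rfl rfl rfl N _ G ha hG
  · intro ha
    induction ha using Algebra.adjoin_induction with
    | mem b hb => rw [Set.mem_singleton_iff.1 hb, hδ, Aux.Dz_z, map_zero]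
    | algebraMap r => exact δ.map_algebraMap r
    | add b c _ _ hb hc => rw [map_add, hb, hc, add_zero]
    | mul b c _ _ hb hc => rw [Derivation.leibniz, hb, hc, smul_zero, smul_zero, add_zero]
end

section
/- Let p, q ∈ ℂ[t] be nonconstant polynomials with p(0) = q(0) = 0 such that 1 − p and 1 − q have only simple roots. Let F = p(x) + q(y) + x·y·z − 1 and A = ℂ[x,y,z]/(F). Let D_y be the ℂ-derivation of ℂ[x,y,z] determined by D_y(x) = −x·y, D_y(y) = 0, D_y(z) = p'(x) + y·z, and let D_x be the ℂ-derivation determined by D_x(x) = 0, D_x(y) = −x·y, D_x(z) = q'(y) + x·z. Then D_y(F) = 0 and D_x(F) = 0, so D_y and D_x induce ℂ-derivations δ_y and δ_x of A; the kernel of δ_y equals the ℂ-subalgebra of A generated by the residue of y, and the kernel of δ_x equals the ℂ-subalgebra of A generated by the residue of x. -/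
open MvPolynomial

/-- The derivation `D_y = −xy ∂/∂x + (p'(x) + yz) ∂/∂z` of `ℂ[x,y,z]`. -/
noncomputable def Dy (p q : Polynomial ℂ) :
    Derivation ℂ (MvPolynomial (Fin 3) ℂ) (MvPolynomial (Fin 3) ℂ) :=
  mkDerivation ℂ
    ![-(X 0 * X 1), 0, Polynomial.aeval (X 0) (Polynomial.derivative p) + X 1 * X 2]

/-- The derivation `D_x = −xy ∂/∂y + (q'(y) + xz) ∂/∂z` of `ℂ[x,y,z]`. -/
noncomputable def Dx (p q : Polynomial ℂ) :
    Derivation ℂ (MvPolynomial (Fin 3) ℂ) (MvPolynomial (Fin 3) ℂ) :=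
  mkDerivation ℂ
    ![0, -(X 0 * X 1), Polynomial.aeval (X 1) (Polynomial.derivative q) + X 0 * X 2]

/-- evaluation of a bivariate polynomial, inner variable at `y`, outer at `x` -/
noncomputable def phiHom {A : Type} [CommRing A] [Algebra ℂ A] (x y : A) :
    Polynomial (Polynomial ℂ) →+* A :=
  Polynomial.eval₂RingHom (Polynomial.aeval (R := ℂ) y).toRingHom x

lemma phi_C {A : Type} [CommRing A] [Algebra ℂ A] (x y : A) (g : Polynomial ℂ) :
    phiHom x y (Polynomial.C g) = Polynomial.aeval y g := by
  simp [phiHom]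

lemma phi_X {A : Type} [CommRing A] [Algebra ℂ A] (x y : A) :
    phiHom x y Polynomial.X = x := by
  simp [phiHom]

lemma phi_map {A : Type} [CommRing A] [Algebra ℂ A] (x y : A) (χ : A →ₐ[ℂ] ℂ)
    (G : Polynomial (Polynomial ℂ)) :
    χ (phiHom x y G) = (G.eval (Polynomial.C (χ x))).eval (χ y) := by
  induction G using Polynomial.induction_on' with
  | add a b ha hb => simp [ha, hb]
  | monomial n g =>
    rw [← Polynomial.C_mul_X_pow_eq_monomial]
    simp only [map_mul, map_pow, phi_C, phi_X, Polynomial.eval_mul, Polynomial.eval_pow,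
      Polynomial.eval_C, Polynomial.eval_X]
    rw [← Polynomial.aeval_algHom_apply, Polynomial.coe_aeval_eq_eval]

lemma phi_der {A : Type} [CommRing A] [Algebra ℂ A] (x y : A) (δ : Derivation ℂ A A)
    (hy : δ y = 0) (G : Polynomial (Polynomial ℂ)) :
    δ (phiHom x y G) = phiHom x y (Polynomial.derivative G) * δ x := by
  induction G using Polynomial.induction_on' with
  | add a b ha hb => simp [ha, hb, add_mul]
  | monomial n g =>
    rw [Polynomial.derivative_monomial, ← Polynomial.C_mul_X_pow_eq_monomial,
      ← Polynomial.C_mul_X_pow_eq_monomial]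
    simp only [map_mul, map_pow, phi_C, phi_X, Derivation.leibniz, Derivation.leibniz_pow,
      Derivation.map_aeval, hy, smul_zero, add_zero, smul_eq_mul, nsmul_eq_mul, map_natCast]
    ring

lemma biv_zero (G : Polynomial (Polynomial ℂ))
    (h : ∀ a b : ℂ, a ≠ 0 → b ≠ 0 → (G.eval (Polynomial.C a)).eval b = 0) : G = 0 := by
  have h1 : ∀ a : ℂ, a ≠ 0 → G.eval (Polynomial.C a) = 0 := by
    intro a ha
    have : Polynomial.X * G.eval (Polynomial.C a) = 0 := by
      apply Polynomial.funext
      intro b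
      by_cases hb : b = 0
      · simp [hb]
      · simp [h a b ha hb]
    simpa using this
  apply Polynomial.eq_zero_of_infinite_isRoot
  have hinf : (Polynomial.C '' ({0}ᶜ : Set ℂ)).Infinite :=
    (Set.Finite.infinite_compl (Set.finite_singleton 0)).image Polynomial.C_injective.injOn
  refine hinf.mono ?_
  rintro _ ⟨a, ha, rfl⟩
  exact h1 a ha

lemma euler_eq (n : ℕ) (G : Polynomial (Polynomial ℂ))
    (h : Polynomial.X * Polynomial.derivative G = (n : Polynomial (Polynomial ℂ)) * G) :
    G = Polynomial.C (G.coeff n) * Polynomial.X ^ n := by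
  ext1 k
  rw [Polynomial.coeff_C_mul, Polynomial.coeff_X_pow]
  by_cases hk : k = n
  · simp [hk]
  · have h2 := congrArg (fun P => Polynomial.coeff P k) h
    have h3 : (k : Polynomial ℂ) * G.coeff k = n * G.coeff k := by
      simp only [Polynomial.coeff_natCast_mul] at h2
      rw [← h2]
      cases k with
      | zero => simp
      | succ k =>
        rw [Polynomial.coeff_X_mul, Polynomial.coeff_derivative]
        push_cast
        ring
    have h4 : ((k : Polynomial ℂ) - n) * G.coeff k = 0 := by rw [sub_mul, h3, sub_self]
    rcases mul_eq_zero.1 h4 with h5 | h5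
    · exact absurd (by exact_mod_cast sub_eq_zero.1 h5) hk
    · simp [h5, hk]

lemma clear_den {A : Type} [CommRing A] [Algebra ℂ A] (p q : Polynomial ℂ) (x y z : A)
    (hgen : Algebra.adjoin ℂ {x, y, z} = ⊤)
    (hrel : Polynomial.aeval x p + Polynomial.aeval y q + x * y * z = 1) (a : A) :
    ∃ (n : ℕ) (G : Polynomial (Polynomial ℂ)), (x * y) ^ n * a = phiHom x y G := by
  have ha : a ∈ Algebra.adjoin ℂ {x, y, z} := by rw [hgen]; trivial
  have hX : phiHom x y (Polynomial.X * Polynomial.C Polynomial.X) = x * y := by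
    rw [map_mul, phi_X, phi_C, Polynomial.aeval_X]
  induction ha using Algebra.adjoin_induction with
  | mem w hw =>
    rcases hw with rfl | rfl | rfl
    · exact ⟨0, Polynomial.X, by simp [phi_X]⟩
    · exact ⟨0, Polynomial.C Polynomial.X, by simp [phi_C]⟩
    · refine ⟨1, 1 - p.map Polynomial.C - Polynomial.C q, ?_⟩
      have : phiHom x y (p.map Polynomial.C) = Polynomial.aeval x p := by
        rw [phiHom, Polynomial.coe_eval₂RingHom, Polynomial.eval₂_map, Polynomial.aeval_def]
        congr 1
        ext c
        simp
      rw [map_sub, map_sub, this, phi_C, map_one, ← hrel]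
      ring
  | algebraMap r => exact ⟨0, Polynomial.C (Polynomial.C r), by simp [phi_C]⟩
  | add u v _ _ hu hv =>
    obtain ⟨n, G, hG⟩ := hu
    obtain ⟨m, H, hH⟩ := hv
    refine ⟨n + m, (Polynomial.X * Polynomial.C Polynomial.X) ^ m * G +
      (Polynomial.X * Polynomial.C Polynomial.X) ^ n * H, ?_⟩
    rw [map_add, map_mul, map_mul, map_pow, map_pow, hX, ← hG, ← hH]
    ring
  | mul u v _ _ hu hv =>
    obtain ⟨n, G, hG⟩ := hu
    obtain ⟨m, H, hH⟩ := hv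
    refine ⟨n + m, G * H, ?_⟩
    rw [map_mul, ← hG, ← hH]
    ring

lemma div_y {A : Type} [CommRing A] [Algebra ℂ A] (y : A)
    (hy : ∀ a, y * a = 0 → a = 0) (χ : A →ₐ[ℂ] ℂ) (hχ : χ y = 0) (a : A) (n : ℕ) :
    ∀ g : Polynomial ℂ, y ^ n * a = Polynomial.aeval y g → a ∈ Algebra.adjoin ℂ {y} := by
  induction n with
  | zero =>
    intro g hg
    rw [pow_zero, one_mul] at hg
    rw [hg]
    exact Polynomial.aeval_mem_adjoin_singleton ℂ y
  | succ n ih =>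
    intro g hg
    have h1 : g.eval 0 = 0 := by
      have := congrArg χ hg
      rw [← Polynomial.aeval_algHom_apply, hχ, Polynomial.coe_aeval_eq_eval] at this
      rw [← this]
      simp [hχ]
    obtain ⟨k, rfl⟩ : Polynomial.X ∣ g := by
      rw [Polynomial.X_dvd_iff, Polynomial.coeff_zero_eq_eval_zero, h1]
    refine ih k ?_
    have : y * (y ^ n * a - Polynomial.aeval y k) = 0 := by
      rw [map_mul, Polynomial.aeval_X] at hg
      linear_combination hg
    exact sub_eq_zero.1 (hy _ this)

lemma ker_eq {A : Type} [CommRing A] [Algebra ℂ A] (p q : Polynomial ℂ) (x y z : A)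
    (hgen : Algebra.adjoin ℂ {x, y, z} = ⊤)
    (hrel : Polynomial.aeval x p + Polynomial.aeval y q + x * y * z = 1)
    (hx : ∀ a, x * a = 0 → a = 0) (hy : ∀ a, y * a = 0 → a = 0)
    (hpt : ∀ a b : ℂ, a ≠ 0 → b ≠ 0 → ∃ χ : A →ₐ[ℂ] ℂ, χ x = a ∧ χ y = b)
    (hpt0 : ∃ χ : A →ₐ[ℂ] ℂ, χ y = 0)
    (δ : Derivation ℂ A A) (hδx : δ x = -(x * y)) (hδy : δ y = 0) :
    {a : A | δ a = 0} = (Algebra.adjoin ℂ {y} : Subalgebra ℂ A) := by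
  ext a
  simp only [Set.mem_ofPred_eq, SetLike.mem_coe]
  constructor
  · intro ha
    obtain ⟨n, G, hG⟩ := clear_den p q x y z hgen hrel a
    have hd : phiHom x y (Polynomial.X * Polynomial.derivative G
        - (n : Polynomial (Polynomial ℂ)) * G) = 0 := by
      apply hy
      have h1 := phi_der x y δ hδy G
      rw [← hG, Derivation.leibniz, ha, smul_zero, zero_add, Derivation.leibniz_pow,
        Derivation.leibniz, hδy, hδx, smul_zero, zero_add] at h1
      simp only [smul_eq_mul, nsmul_eq_mul] at h1
      rw [map_sub, map_mul, map_mul, map_natCast, phi_X, ← hG]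
      cases n with
      | zero => simp at h1 ⊢; linear_combination h1
      | succ n => simp only [Nat.add_sub_cancel] at h1; linear_combination h1
    have hz := biv_zero _ (fun s t hs ht => by
      obtain ⟨χ, h1, h2⟩ := hpt s t hs ht
      have := phi_map x y χ (Polynomial.X * Polynomial.derivative G
        - (n : Polynomial (Polynomial ℂ)) * G)
      rw [hd, map_zero, h1, h2] at this
      exact this.symm)
    have hE := euler_eq n G (sub_eq_zero.1 hz)
    have hxn : ∀ m : ℕ, ∀ b, x ^ m * b = 0 → b = 0 := by
      intro m
      induction m with
      | zero => intro b hb; simpa using hb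
      | succ m ih =>
        intro b hb
        exact ih b (hx _ (by rw [← hb]; ring))
    obtain ⟨χ, hχ⟩ := hpt0
    refine div_y y hy χ hχ a n (G.coeff n) ?_
    rw [hE, map_mul, map_pow, phi_C, phi_X] at hG
    exact sub_eq_zero.1 (hxn n _ (by linear_combination hG))
  · intro ha
    induction ha using Algebra.adjoin_induction with
    | mem w hw => rw [Set.mem_singleton_iff.1 hw, hδy]
    | algebraMap r => simp
    | add u v _ _ hu hv => simp [hu, hv]
    | mul u v _ _ hu hv => simp [hu, hv]

lemma eval_F (p q : Polynomial ℂ) (v : Fin 3 → ℂ) :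
    aeval v (Fpoly p q) = p.eval (v 0) + q.eval (v 1) + v 0 * v 1 * v 2 - 1 := by
  simp only [Fpoly, map_sub, map_add, map_mul, map_one, aeval_X,
    ← Polynomial.aeval_algHom_apply, Polynomial.coe_aeval_eq_eval]

lemma point (p q : Polynomial ℂ) (v : Fin 3 → ℂ)
    (h : p.eval (v 0) + q.eval (v 1) + v 0 * v 1 * v 2 - 1 = 0) :
    ∃ χ : SurfRing p q →ₐ[ℂ] ℂ, ∀ g : MvPolynomial (Fin 3) ℂ,
      χ (Ideal.Quotient.mk (Ideal.span {Fpoly p q}) g) = aeval v g := by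
  refine ⟨Ideal.Quotient.liftₐ _ (aeval v) ?_, fun g => rfl⟩
  intro a ha
  obtain ⟨c, rfl⟩ := Ideal.mem_span_singleton.1 ha
  rw [map_mul, eval_F, h, zero_mul]

lemma nzd (p q : Polynomial ℂ) (hp0 : p.eval 0 = 0) (hq0 : q.eval 0 = 0) (i : Fin 3)
    (a : SurfRing p q)
    (h : Ideal.Quotient.mk (Ideal.span {Fpoly p q}) (X i) * a = 0) : a = 0 := by
  obtain ⟨g, rfl⟩ := Ideal.Quotient.mk_surjective a
  rw [← map_mul, Ideal.Quotient.eq_zero_iff_mem, Ideal.mem_span_singleton] at h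
  rw [Ideal.Quotient.eq_zero_iff_mem, Ideal.mem_span_singleton]
  obtain ⟨k, hk⟩ := h
  have hpr : Prime (X i : MvPolynomial (Fin 3) ℂ) := X_prime
  rcases hpr.dvd_or_dvd (Dvd.intro _ hk) with ⟨c, hc⟩ | ⟨c, rfl⟩
  · have := eval_F p q 0
    rw [hc] at this
    simp [hp0, hq0] at this
  · refine ⟨c, mul_left_cancel₀ hpr.ne_zero ?_⟩
    rw [hk]
    ring

lemma gen_top (p q : Polynomial ℂ) :
    Algebra.adjoin ℂ {Ideal.Quotient.mk (Ideal.span {Fpoly p q}) (X 0),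
      Ideal.Quotient.mk (Ideal.span {Fpoly p q}) (X 1),
      Ideal.Quotient.mk (Ideal.span {Fpoly p q}) (X 2)} = ⊤ := by
  rw [eq_top_iff]
  rintro a -
  obtain ⟨g, rfl⟩ := Ideal.Quotient.mk_surjective a
  induction g using MvPolynomial.induction_on with
  | C c => exact Subalgebra.algebraMap_mem _ c
  | add u v hu hv => rw [map_add]; exact add_mem hu hv
  | mul_X u i hu =>
    rw [map_mul]
    refine mul_mem hu (Algebra.subset_adjoin ?_)
    fin_cases i <;> simp

lemma rel_eq (p q : Polynomial ℂ) :
    Polynomial.aeval (Ideal.Quotient.mk (Ideal.span {Fpoly p q}) (X 0)) p +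
    Polynomial.aeval (Ideal.Quotient.mk (Ideal.span {Fpoly p q}) (X 1)) q +
    Ideal.Quotient.mk (Ideal.span {Fpoly p q}) (X 0) *
    Ideal.Quotient.mk (Ideal.span {Fpoly p q}) (X 1) *
    Ideal.Quotient.mk (Ideal.span {Fpoly p q}) (X 2) = 1 := by
  have h : Ideal.Quotient.mkₐ ℂ (Ideal.span {Fpoly p q}) (Fpoly p q) = 0 :=
    Ideal.Quotient.eq_zero_iff_mem.2 (Ideal.mem_span_singleton_self _)
  conv at h => lhs; arg 2; rw [Fpoly]
  simp only [map_sub, map_add, map_mul, map_one, ← Polynomial.aeval_algHom_apply,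
    Ideal.Quotient.mkₐ_eq_mk] at h
  exact sub_eq_zero.1 h

lemma exists_der (p q : Polynomial ℂ)
    (D : Derivation ℂ (MvPolynomial (Fin 3) ℂ) (MvPolynomial (Fin 3) ℂ))
    (hD : D (Fpoly p q) = 0) :
    ∃ δ : Derivation ℂ (SurfRing p q) (SurfRing p q),
      (∀ g : MvPolynomial (Fin 3) ℂ,
        δ (Ideal.Quotient.mk (Ideal.span {Fpoly p q}) g) =
          Ideal.Quotient.mk (Ideal.span {Fpoly p q}) (D g)) := by
  refine ⟨Derivation.liftOfSurjective (f := Ideal.Quotient.mkₐ ℂ (Ideal.span {Fpoly p q}))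
    Ideal.Quotient.mk_surjective (d := D) ?_, fun g => ?_⟩
  · intro a ha
    obtain ⟨c, rfl⟩ := Ideal.mem_span_singleton.1 (Ideal.Quotient.eq_zero_iff_mem.1 ha)
    refine Ideal.Quotient.eq_zero_iff_mem.2 (Ideal.mem_span_singleton.2 ⟨D c, ?_⟩)
    rw [Derivation.leibniz, hD, smul_zero, add_zero, smul_eq_mul]
  · exact Derivation.liftOfSurjective_apply (f := Ideal.Quotient.mkₐ ℂ (Ideal.span {Fpoly p q}))
      Ideal.Quotient.mk_surjective _ g

lemma root_one (p : Polynomial ℂ) (hp : 0 < p.natDegree) : ∃ a, p.eval a = 1 := by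
  obtain ⟨a, ha⟩ := IsAlgClosed.exists_root (p - Polynomial.C 1) (by
    rw [Polynomial.degree_sub_C (Polynomial.natDegree_pos_iff_degree_pos.1 hp)]
    exact (Polynomial.natDegree_pos_iff_degree_pos.1 hp).ne')
  refine ⟨a, ?_⟩
  simpa [Polynomial.IsRoot, sub_eq_zero] using ha

lemma gen_pt (p q : Polynomial ℂ) (a b : ℂ) (ha : a ≠ 0) (hb : b ≠ 0) :
    ∃ χ : SurfRing p q →ₐ[ℂ] ℂ, χ (Ideal.Quotient.mk (Ideal.span {Fpoly p q}) (X 0)) = a ∧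
      χ (Ideal.Quotient.mk (Ideal.span {Fpoly p q}) (X 1)) = b := by
  obtain ⟨χ, h⟩ := point p q ![a, b, (1 - p.eval a - q.eval b) / (a * b)] (by
    simp
    field_simp
    ring)
  exact ⟨χ, by simp [h], by simp [h]⟩

/-- `D_y` and `D_x` annihilate `F`, hence induce derivations `δ_y`, `δ_x` of
`A = ℂ[x,y,z]/(F)` whose kernels are the `ℂ`-subalgebras generated by the residues of
`y` and `x` respectively. -/
theorem stmt6 (p q : Polynomial ℂ) (hp : 0 < p.natDegree) (hq : 0 < q.natDegree)
    (hp0 : p.eval 0 = 0) (hq0 : q.eval 0 = 0)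
    (hps : Squarefree (1 - p)) (hqs : Squarefree (1 - q)) :
    Dy p q (Fpoly p q) = 0 ∧ Dx p q (Fpoly p q) = 0 ∧
    (∃ δ : Derivation ℂ (SurfRing p q) (SurfRing p q),
      (∀ g : MvPolynomial (Fin 3) ℂ,
        δ (Ideal.Quotient.mk (Ideal.span {Fpoly p q}) g) =
          Ideal.Quotient.mk (Ideal.span {Fpoly p q}) (Dy p q g)) ∧
      {a : SurfRing p q | δ a = 0} =
        (Algebra.adjoin ℂ {Ideal.Quotient.mk (Ideal.span {Fpoly p q}) (X 1)} :
          Subalgebra ℂ (SurfRing p q))) ∧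
    (∃ δ : Derivation ℂ (SurfRing p q) (SurfRing p q),
      (∀ g : MvPolynomial (Fin 3) ℂ,
        δ (Ideal.Quotient.mk (Ideal.span {Fpoly p q}) g) =
          Ideal.Quotient.mk (Ideal.span {Fpoly p q}) (Dx p q g)) ∧
      {a : SurfRing p q | δ a = 0} =
        (Algebra.adjoin ℂ {Ideal.Quotient.mk (Ideal.span {Fpoly p q}) (X 0)} :
          Subalgebra ℂ (SurfRing p q))) := by
  have hDy : Dy p q (Fpoly p q) = 0 := by
    simp only [Fpoly, Dy, map_sub, map_add, Derivation.leibniz, Derivation.map_aeval,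
      mkDerivation_X, Derivation.map_one_eq_zero, smul_eq_mul]
    simp
    ring
  have hDx : Dx p q (Fpoly p q) = 0 := by
    simp only [Fpoly, Dx, map_sub, map_add, Derivation.leibniz, Derivation.map_aeval,
      mkDerivation_X, Derivation.map_one_eq_zero, smul_eq_mul]
    simp
    ring
  refine ⟨hDy, hDx, ?_, ?_⟩
  · obtain ⟨δ, hδ⟩ := exists_der p q _ hDy
    refine ⟨δ, hδ, ?_⟩
    refine ker_eq p q _ _ _ (gen_top p q) (rel_eq p q) (nzd p q hp0 hq0 0) (nzd p q hp0 hq0 1)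
      (gen_pt p q) ?_ δ ?_ ?_
    · obtain ⟨a, ha⟩ := root_one p hp
      obtain ⟨χ, h⟩ := point p q ![a, 0, 0] (by simp [ha, hq0])
      exact ⟨χ, by simp [h]⟩
    · rw [hδ, Dy, mkDerivation_X]; simp
    · rw [hδ, Dy, mkDerivation_X]; simp
  · obtain ⟨δ, hδ⟩ := exists_der p q _ hDx
    refine ⟨δ, hδ, ?_⟩
    refine ker_eq q p (Ideal.Quotient.mk _ (X 1)) _ (Ideal.Quotient.mk _ (X 2)) ?_ ?_
      (nzd p q hp0 hq0 1) (nzd p q hp0 hq0 0) ?_ ?_ δ ?_ ?_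
    · rw [Set.insert_comm]; exact gen_top p q
    · rw [← rel_eq p q]; ring
    · intro a b ha hb
      obtain ⟨χ, h1, h2⟩ := gen_pt p q b a hb ha
      exact ⟨χ, h2, h1⟩
    · obtain ⟨a, ha⟩ := root_one q hq
      obtain ⟨χ, h⟩ := point p q ![0, a, 0] (by simp [ha, hp0])
      exact ⟨χ, by simp [h]⟩
    · rw [hδ, Dx, mkDerivation_X]; simp [mul_comm]
    · rw [hδ, Dx, mkDerivation_X]; simp
end

section
/- Let p, q ∈ ℂ[t] be nonconstant polynomials with p(0) = q(0) = 0 such that 1 − p and 1 − q have only simple roots. Then the set { (x, y, z) ∈ ℂ³ : p(x) + q(y) + x·y·z = 1, q'(y) + x·z = 0, p'(x) + y·z = 0 } is finite. -/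
open TensorProduct in
lemma aux_ff {F K M : Type*} [Field F] [Field K] [Algebra F K] [AddCommGroup M] [Module F M]
    (m : M) (h : (1 : K) ⊗ₜ[F] m = 0) : m = 0 :=
  (Module.FaithfullyFlat.one_tmul_eq_zero_iff F M (A := K) m).1 h

open Polynomial KaehlerDifferential in
lemma aux_const {K : Type*} [Field K] [Algebra ℂ K] (u : K)
    (hu : KaehlerDifferential.D ℂ K u = 0) : ∃ c : ℂ, algebraMap ℂ K c = u := by
  let F := IntermediateField.adjoin ℂ ({u} : Set K)
  have hsm : Algebra.FormallySmooth F K := by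
    obtain ⟨s, hs⟩ := exists_isTranscendenceBasis F K
    have := hs.isAlgebraic_field
    have : CharZero F := charZero_of_injective_algebraMap (algebraMap ℂ F).injective
    exact Algebra.FormallySmooth.of_algebraicIndependent_of_isSeparable hs.1
  have hsub := hsm.subsingleton_h1Cotangent
  have hinj : Function.Injective (KaehlerDifferential.mapBaseChange ℂ F K) := by
    rw [injective_iff_map_eq_zero]
    intro a ha
    obtain ⟨b, rfl⟩ := (Algebra.H1Cotangent.exact_δ_mapBaseChange ℂ F K a).1 ha
    rw [Subsingleton.elim b 0, map_zero]
  have hD : ∀ v : F, KaehlerDifferential.D ℂ K (v : K) = 0 := by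
    rintro ⟨v, hv⟩
    induction hv using IntermediateField.adjoin_induction with
    | mem x hx => rw [Set.mem_singleton_iff] at hx; subst hx; exact hu
    | algebraMap x => simp
    | add x y hx hy h1 h2 => simp_all
    | inv x hx h => simp_all [Derivation.leibniz_inv]
    | mul x y hx hy h1 h2 => simp_all
  have hDF : ∀ v : F, KaehlerDifferential.D ℂ F v = 0 := by
    intro v
    refine aux_ff (F := F) (K := K) (M := Ω[F⁄ℂ]) _ ?_
    apply hinj
    rw [map_zero, KaehlerDifferential.mapBaseChange_tmul, KaehlerDifferential.map_D, one_smul]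
    exact hD v
  have hun : Algebra.FormallyUnramified ℂ F := by
    constructor
    rw [← Submodule.subsingleton_iff F, ← subsingleton_iff_bot_eq_top,
      ← KaehlerDifferential.span_range_derivation, eq_comm, Submodule.span_eq_bot]
    rintro _ ⟨v, rfl⟩
    exact hDF v
  have hfin : Algebra.EssFiniteType ℂ F :=
    IntermediateField.essFiniteType_iff.2
      (IntermediateField.fg_adjoin_of_finite (Set.finite_singleton u))
  obtain ⟨c, hc⟩ := (Algebra.FormallyUnramified.bijective_of_isAlgClosed_of_isLocalRing ℂ F).2
    ⟨u, IntermediateField.mem_adjoin_simple_self ℂ u⟩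
  exact ⟨c, congrArg (Subtype.val) hc⟩

open Polynomial in
lemma aux_root {K : Type*} [Field K] [Algebra ℂ K] (x : K) (f : ℂ[X]) (hf : f ≠ 0)
    (h : aeval x f = 0) : ∃ c : ℂ, algebraMap ℂ K c = x := by
  have h1 : IsIntegral ℂ x := IsAlgebraic.isIntegral ⟨f, hf, h⟩
  have h2 := IsAlgClosed.degree_eq_one_of_irreducible ℂ (minpoly.irreducible h1)
  exact minpoly.mem_range_of_degree_eq_one ℂ x h2

open Polynomial in
lemma aux_unit (p q : ℂ[X]) (hq0 : q.eval 0 = 0) (hps : Squarefree (1 - p)) :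
    ∃ a b q1 : ℂ[X], ∀ (K : Type) [Field K] [Algebra ℂ K] (x y z : K),
      aeval x p + aeval y q + x * y * z = 1 → aeval x (derivative p) + y * z = 0 →
      y * (aeval x a * (aeval y q1 + x * z) + aeval x b * z) = 1 := by
  obtain ⟨q1, rfl⟩ : X ∣ q := by rw [X_dvd_iff, coeff_zero_eq_eval_zero]; exact hq0
  obtain ⟨a, b, hab⟩ := (PerfectField.separable_iff_squarefree.2 hps)
  refine ⟨a, b, q1, fun K _ _ x y z h1 h2 => ?_⟩
  have := congrArg (aeval x) hab
  simp only [map_add, map_mul, map_sub, map_one, derivative_sub, derivative_one, aeval_X, zero_sub,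
    map_neg] at this h1
  linear_combination this + aeval x a * h1 + aeval x b * h2

open Polynomial in
lemma aux_field (p q : ℂ[X]) (hp : 0 < p.natDegree) (hq : 0 < q.natDegree)
    (hp0 : p.eval 0 = 0) (hq0 : q.eval 0 = 0)
    (hps : Squarefree (1 - p)) (hqs : Squarefree (1 - q))
    (K : Type) [Field K] [Algebra ℂ K] (x y z : K)
    (h1 : aeval x p + aeval y q + x * y * z = 1)
    (h2 : aeval y (derivative q) + x * z = 0)
    (h3 : aeval x (derivative p) + y * z = 0) :
    ∃ a b c : ℂ, algebraMap ℂ K a = x ∧ algebraMap ℂ K b = y ∧ algebraMap ℂ K c = z := by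
  obtain ⟨a, b, q1, hy⟩ := aux_unit p q hq0 hps
  obtain ⟨a', b', p1, hx⟩ := aux_unit q p hp0 hqs
  replace hy := hy K x y z h1 h3
  replace hx := hx K y x z (by linear_combination h1) h2
  have hx0 : x ≠ 0 := by rintro rfl; simp at hx
  have hy0 : y ≠ 0 := by rintro rfl; simp at hy
  have hz : ∃ c : ℂ, algebraMap ℂ K c = z := by
    apply aux_const
    have h := congrArg (KaehlerDifferential.D ℂ K) h1
    simp only [map_add, Derivation.map_aeval, Derivation.leibniz, Derivation.map_one_eq_zero] at h
    rw [eq_neg_of_add_eq_zero_left h2, eq_neg_of_add_eq_zero_left h3] at h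
    have h' : (x * y) • KaehlerDifferential.D ℂ K z = 0 := by
      rw [← h]; module
    exact (smul_eq_zero.1 h').resolve_left (mul_ne_zero hx0 hy0)
  obtain ⟨c, rfl⟩ := hz
  have hdp : derivative p ≠ 0 := fun h => hp.ne' (natDegree_eq_zero_of_derivative_eq_zero h)
  have hdq : derivative q ≠ 0 := fun h => hq.ne' (natDegree_eq_zero_of_derivative_eq_zero h)
  by_cases hc : c = 0
  · subst hc
    obtain ⟨r, hr⟩ := aux_root x _ hdp (by simpa using h3)
    obtain ⟨s, hs⟩ := aux_root y _ hdq (by simpa using h2)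
    exact ⟨r, s, 0, hr, hs, rfl⟩
  · have hc' : algebraMap ℂ K c ≠ 0 := by simpa using hc
    let Y : ℂ[X] := C (-c⁻¹) * derivative p
    have hY : y = aeval x Y := by
      simp only [Y, map_mul, aeval_C, map_neg, map_inv₀]
      field_simp
      linear_combination h3
    have hxr : ∃ r : ℂ, algebraMap ℂ K r = x := by
      apply aux_root x (X * (a'.comp Y * (p1 + Y * C c) + b'.comp Y * C c) - 1)
      · intro h
        have := congrArg (eval 0) h
        simp at this
      · simp only [map_sub, map_mul, map_add, aeval_X, aeval_comp, ← hY, aeval_C, map_one]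
        rw [hx, sub_self]
    obtain ⟨r, rfl⟩ := hxr
    exact ⟨r, Y.eval r, c, rfl, by rw [hY, aeval_algebraMap_apply, coe_aeval_eq_eval], rfl⟩

/-- The vanishing locus of the vector field `δ_z = (q'(y)+xz) ∂/∂x − (p'(x)+yz) ∂/∂y` on
the surface `p(x) + q(y) + xyz = 1` in `ℂ³` is finite. -/
theorem stmt7 (p q : Polynomial ℂ) (hp : 0 < p.natDegree) (hq : 0 < q.natDegree)
    (hp0 : p.eval 0 = 0) (hq0 : q.eval 0 = 0)
    (hps : Squarefree (1 - p)) (hqs : Squarefree (1 - q)) :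
    {w : ℂ × ℂ × ℂ |
      p.eval w.1 + q.eval w.2.1 + w.1 * w.2.1 * w.2.2 = 1 ∧
      (Polynomial.derivative q).eval w.2.1 + w.1 * w.2.2 = 0 ∧
      (Polynomial.derivative p).eval w.1 + w.2.1 * w.2.2 = 0}.Finite := by
  by_contra hinf
  set S := {w : ℂ × ℂ × ℂ |
      p.eval w.1 + q.eval w.2.1 + w.1 * w.2.1 * w.2.2 = 1 ∧
      (Polynomial.derivative q).eval w.2.1 + w.1 * w.2.2 = 0 ∧
      (Polynomial.derivative p).eval w.1 + w.2.1 * w.2.2 = 0} with hS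
  have : Infinite S := Set.infinite_coe_iff.2 hinf
  let φ : Ultrafilter S := Filter.hyperfilter S
  let K := Filter.Germ (φ : Filter S) ℂ
  let R : (S → ℂ) →+* K := Filter.Germ.coeRingHom (φ : Filter S)
  letI : Algebra ℂ K := (R.comp (Pi.constRingHom S ℂ)).toAlgebra
  have hev : ∀ (f : S → ℂ) (r : Polynomial ℂ),
      Polynomial.aeval (R f) r = R (fun i => r.eval (f i)) := by
    intro f r
    have : (fun i => r.eval (f i)) = r.eval₂ (Pi.constRingHom S ℂ) f := by
      funext i
      have := Polynomial.hom_eval₂ r (Pi.constRingHom S ℂ) (Pi.evalRingHom (fun _ : S => ℂ) i) f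
      simp only [Pi.evalRingHom_apply] at this
      rw [this]
      rfl
    rw [this, Polynomial.hom_eval₂]
    rfl
  let fx : S → ℂ := fun i => i.1.1
  let fy : S → ℂ := fun i => i.1.2.1
  let fz : S → ℂ := fun i => i.1.2.2
  obtain ⟨a, b, c, ha, hb, hc⟩ := aux_field p q hp hq hp0 hq0 hps hqs K (R fx) (R fy) (R fz)
    (by
      rw [hev, hev, ← map_mul, ← map_mul, ← map_add, ← map_add, ← map_one R]
      congr 1; funext i; exact i.2.1)
    (by
      rw [hev, ← map_mul, ← map_add, ← map_zero R]
      congr 1; funext i; exact i.2.2.1)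
    (by
      rw [hev, ← map_mul, ← map_add, ← map_zero R]
      congr 1; funext i; exact i.2.2.2)
  have ha' : ∀ᶠ i in (φ : Filter S), a = fx i := Filter.Germ.coe_eq.1 ha
  have hb' : ∀ᶠ i in (φ : Filter S), b = fy i := Filter.Germ.coe_eq.1 hb
  have hc' : ∀ᶠ i in (φ : Filter S), c = fz i := Filter.Germ.coe_eq.1 hc
  have hall := (ha'.and hb').and hc'
  refine Filter.notMem_hyperfilter_of_finite (s := {i : S | (a = fx i ∧ b = fy i) ∧ c = fz i})
    (Set.Subsingleton.finite ?_) hall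
  rintro i ⟨⟨h1, h2⟩, h3⟩ j ⟨⟨h4, h5⟩, h6⟩
  apply Subtype.ext
  exact Prod.ext (h1.symm.trans h4) (Prod.ext (h2.symm.trans h5) (h3.symm.trans h6))
end

section
/- Let p, q ∈ ℂ[t] be nonconstant polynomials with p(0) = q(0) = 0 such that 1 − p and 1 − q have only simple roots. Then both of the following sets are finite: { (x, y, z) ∈ ℂ³ : p(x) + q(y) + x·y·z = 1, x·y = 0, p'(x) + y·z = 0 } and { (x, y, z) ∈ ℂ³ : p(x) + q(y) + x·y·z = 1, x·y = 0, q'(y) + x·z = 0 }. -/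
theorem aux_simple (p : Polynomial ℂ) (hps : Squarefree (1 - p)) (x : ℂ)
    (h1 : p.eval x = 1) (h2 : (Polynomial.derivative p).eval x = 0) : False := by
  have hs : (1 - p).Separable := PerfectField.separable_iff_squarefree.mpr hps
  obtain ⟨a, b, hab⟩ := hs
  have := congrArg (Polynomial.eval x) hab
  simp [h1, h2] at this

theorem aux_roots (q : Polynomial ℂ) (hqs : Squarefree (1 - q)) :
    {y : ℂ | q.eval y = 1}.Finite := by
  refine ((1 - q).roots.toFinset.finite_toSet).subset ?_
  intro y hy
  have hy' : q.eval y = 1 := hy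
  simp [hqs.ne_zero, hy']

theorem aux_key (p q : Polynomial ℂ) (hp0 : p.eval 0 = 0)
    (hps : Squarefree (1 - p)) (hq0 : q.eval 0 = 0) (x y z : ℂ)
    (h1 : p.eval x + q.eval y + x * y * z = 1) (h2 : x * y = 0)
    (h3 : (Polynomial.derivative p).eval x + y * z = 0) :
    q.eval y = 1 ∧ x = 0 ∧ z = -(Polynomial.derivative p).eval 0 / y := by
  by_cases hy : y = 0
  · subst hy
    exact (aux_simple p hps x (by simpa [hq0] using h1) (by simpa using h3)).elim
  · have hx : x = 0 := (mul_eq_zero.mp h2).resolve_right hy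
    subst hx
    refine ⟨by simpa [hp0] using h1, rfl, ?_⟩
    rw [eq_div_iff hy]
    linear_combination h3

/-- The vanishing loci of the vector fields `δ_y = −xy ∂/∂x + (p'(x)+yz) ∂/∂z` and
`δ_x = −xy ∂/∂y + (q'(y)+xz) ∂/∂z` on the surface `p(x) + q(y) + xyz = 1` in `ℂ³`
are finite. -/
theorem stmt8 (p q : Polynomial ℂ) (hp : 0 < p.natDegree) (hq : 0 < q.natDegree)
    (hp0 : p.eval 0 = 0) (hq0 : q.eval 0 = 0)
    (hps : Squarefree (1 - p)) (hqs : Squarefree (1 - q)) :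
    {w : ℂ × ℂ × ℂ |
      p.eval w.1 + q.eval w.2.1 + w.1 * w.2.1 * w.2.2 = 1 ∧
      w.1 * w.2.1 = 0 ∧
      (Polynomial.derivative p).eval w.1 + w.2.1 * w.2.2 = 0}.Finite ∧
    {w : ℂ × ℂ × ℂ |
      p.eval w.1 + q.eval w.2.1 + w.1 * w.2.1 * w.2.2 = 1 ∧
      w.1 * w.2.1 = 0 ∧
      (Polynomial.derivative q).eval w.2.1 + w.1 * w.2.2 = 0}.Finite := by
  constructor
  · refine ((aux_roots q hqs).image
      (fun y => ((0 : ℂ), y, -(Polynomial.derivative p).eval 0 / y))).subset ?_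
    rintro ⟨x, y, z⟩ ⟨h1, h2, h3⟩
    obtain ⟨ha, hb, hc⟩ := aux_key p q hp0 hps hq0 x y z h1 h2 h3
    exact ⟨y, ha, by simp only [hb, hc]⟩
  · refine ((aux_roots p hps).image
      (fun x => (x, (0 : ℂ), -(Polynomial.derivative q).eval 0 / x))).subset ?_
    rintro ⟨x, y, z⟩ ⟨h1, h2, h3⟩
    dsimp only at h1 h2 h3
    obtain ⟨ha, hb, hc⟩ := aux_key q p hq0 hqs hp0 y x z
      (by linear_combination h1) (by linear_combination h2) h3
    exact ⟨x, ha, by simp only [hb, hc]⟩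
end

section
/- Let R = ℂ[a₁,a₂,b₁,b₂]/(a₁b₂ − a₂b₁ − 1). For each t ∈ ℂˣ the assignment a₁ ↦ t·a₁, a₂ ↦ t·a₂, b₁ ↦ t⁻¹·b₁, b₂ ↦ t⁻¹·b₂ preserves the relation a₁b₂ − a₂b₁ − 1 and hence defines a ℂ-algebra automorphism σ_t of R. The ℂ-algebra homomorphism φ : ℂ[U,V,Z] → R with φ(U) = a₁b₁, φ(V) = a₂b₂, φ(Z) = a₂b₁ has kernel equal to the principal ideal generated by U·V − Z² − Z, and its image equals the subalgebra { r ∈ R : σ_t(r) = r for all t ∈ ℂˣ } of ℂˣ-invariants. In particular the invariant subalgebra is isomorphic to ℂ[U,V,Z]/(UV − Z(Z+1)). -/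
open MvPolynomial

/-- The relation `a₁b₂ − a₂b₁ − 1` in `ℂ[a₁,a₂,b₁,b₂]`
(with `a₁ = X 0`, `a₂ = X 1`, `b₁ = X 2`, `b₂ = X 3`). -/
noncomputable def sl2Rel : MvPolynomial (Fin 4) ℂ :=
  X 0 * X 3 - X 1 * X 2 - 1

/-- The coordinate ring `R = ℂ[a₁,a₂,b₁,b₂]/(a₁b₂ − a₂b₁ − 1)` of `SL₂(ℂ)`. -/
abbrev SL2Ring : Type := MvPolynomial (Fin 4) ℂ ⧸ Ideal.span {sl2Rel}

/-- The quotient map `ℂ[a₁,a₂,b₁,b₂] → R`. -/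
noncomputable def mkSL2 : MvPolynomial (Fin 4) ℂ →+* SL2Ring :=
  Ideal.Quotient.mk (Ideal.span {sl2Rel})

/-- The `ℂ`-algebra map `φ : ℂ[U,V,Z] → R`, `U ↦ a₁b₁`, `V ↦ a₂b₂`, `Z ↦ a₂b₁`. -/
noncomputable def phiInv : MvPolynomial (Fin 3) ℂ →ₐ[ℂ] SL2Ring :=
  aeval ![mkSL2 (X 0 * X 2), mkSL2 (X 1 * X 3), mkSL2 (X 1 * X 2)]

theorem mkSL2_rel : mkSL2 (X 0) * mkSL2 (X 3) - mkSL2 (X 1) * mkSL2 (X 2) = 1 := by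
  have h : mkSL2 (X 0 * X 3 - X 1 * X 2 - 1) = 0 :=
    Ideal.Quotient.eq_zero_iff_mem.mpr (Ideal.subset_span rfl)
  rw [map_sub, map_sub, map_mul, map_mul, map_one] at h
  exact sub_eq_zero.mp h

noncomputable def liftSL2 {A : Type*} [CommRing A] [Algebra ℂ A] (v : Fin 4 → A)
    (h : v 0 * v 3 - v 1 * v 2 = 1) : SL2Ring →ₐ[ℂ] A :=
  Ideal.Quotient.liftₐ (Ideal.span {sl2Rel}) (aeval v) (by
    have : Ideal.span {sl2Rel} ≤ RingHom.ker (aeval v : MvPolynomial (Fin 4) ℂ →ₐ[ℂ] A) := by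
      rw [Ideal.span_singleton_le_iff_mem, RingHom.mem_ker]
      simp [sl2Rel, h]
    intro a ha
    exact this ha)

theorem liftSL2_mk {A : Type*} [CommRing A] [Algebra ℂ A] (v : Fin 4 → A)
    (h : v 0 * v 3 - v 1 * v 2 = 1) (p : MvPolynomial (Fin 4) ℂ) :
    liftSL2 v h (mkSL2 p) = aeval v p := by
  rfl

theorem liftSL2_X {A : Type*} [CommRing A] [Algebra ℂ A] (v : Fin 4 → A)
    (h : v 0 * v 3 - v 1 * v 2 = 1) (i : Fin 4) :
    liftSL2 v h (mkSL2 (X i)) = v i := by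
  rw [liftSL2_mk, aeval_X]

theorem SL2_ext {A : Type*} [CommRing A] [Algebra ℂ A] (f g : SL2Ring →ₐ[ℂ] A)
    (h : ∀ i, f (mkSL2 (X i)) = g (mkSL2 (X i))) : f = g := by
  apply Ideal.Quotient.algHom_ext
  apply MvPolynomial.algHom_ext
  exact h

theorem smul_cancel (t : ℂˣ) (x y : SL2Ring) :
    ((t : ℂ) • x) * ((t : ℂ)⁻¹ • y) = x * y := by
  rw [smul_mul_smul_comm, mul_inv_cancel₀ t.ne_zero, one_smul]

/-- the weights -/
def wtU (t : ℂˣ) : Fin 4 → ℂˣ := ![t, t, t⁻¹, t⁻¹]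

noncomputable def sgHom (t : ℂˣ) : SL2Ring →ₐ[ℂ] SL2Ring :=
  liftSL2 (fun i => ((wtU t i : ℂˣ) : ℂ) • mkSL2 (X i)) (by
    simpa [wtU, smul_cancel] using mkSL2_rel)

theorem sgHom_X (t : ℂˣ) (i : Fin 4) :
    sgHom t (mkSL2 (X i)) = ((wtU t i : ℂˣ) : ℂ) • mkSL2 (X i) := liftSL2_X _ _ i

theorem sgHom_comp (t s : ℂˣ) (h : s * t = 1) :
    (sgHom t).comp (sgHom s) = AlgHom.id ℂ SL2Ring := by
  apply SL2_ext
  intro i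
  obtain rfl : s = t⁻¹ := eq_inv_of_mul_eq_one_left h
  rw [AlgHom.comp_apply, sgHom_X, map_smul, sgHom_X, smul_smul]
  fin_cases i <;> simp [wtU]

noncomputable def sgEquiv (t : ℂˣ) : SL2Ring ≃ₐ[ℂ] SL2Ring :=
  AlgEquiv.ofAlgHom (sgHom t) (sgHom t⁻¹) (sgHom_comp _ _ (by simp)) (sgHom_comp _ _ (by simp))

theorem sgEquiv_apply (t : ℂˣ) (r : SL2Ring) : sgEquiv t r = sgHom t r := rfl

theorem phi_X0 : phiInv (X 0) = mkSL2 (X 0) * mkSL2 (X 2) := by simp [phiInv]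
theorem phi_X1 : phiInv (X 1) = mkSL2 (X 1) * mkSL2 (X 3) := by simp [phiInv]
theorem phi_X2 : phiInv (X 2) = mkSL2 (X 1) * mkSL2 (X 2) := by simp [phiInv]

/-! kernel -/

noncomputable def fRel : MvPolynomial (Fin 3) ℂ := X 0 * X 1 - X 2 ^ 2 - X 2

noncomputable def iot : MvPolynomial (Fin 2) ℂ →ₐ[ℂ] MvPolynomial (Fin 3) ℂ :=
  aeval ![X 0, X 2]

theorem reduce (p : MvPolynomial (Fin 3) ℂ) :
    ∃ (n : ℕ) (q : MvPolynomial (Fin 2) ℂ) (g : MvPolynomial (Fin 3) ℂ),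
      X 0 ^ n * p = iot q + fRel * g := by
  have i0 : iot (X 0) = X 0 := by simp [iot]
  have i1 : iot (X 1) = X 2 := by simp [iot]
  induction p using MvPolynomial.induction_on with
  | C a => exact ⟨0, C a, 0, by simp [iot, algebraMap_eq]⟩
  | add p p' h h' =>
    obtain ⟨n, q, g, h⟩ := h
    obtain ⟨n', q', g', h'⟩ := h'
    refine ⟨n + n', X 0 ^ n' * q + X 0 ^ n * q', X 0 ^ n' * g + X 0 ^ n * g', ?_⟩
    simp only [map_add, map_mul, map_pow, i0]
    linear_combination X 0 ^ n' * h + X 0 ^ n * h'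
  | mul_X p i h =>
    obtain ⟨n, q, g, h⟩ := h
    fin_cases i
    · refine ⟨n, q * X 0, g * X 0, ?_⟩
      simp only [map_mul, i0, Fin.zero_eta]
      linear_combination X 0 * h
    · refine ⟨n + 1, q * (X 1 ^ 2 + X 1), g * (X 2 ^ 2 + X 2) + X 0 ^ n * p, ?_⟩
      simp only [map_mul, map_add, map_pow, i1, Fin.mk_one]
      rw [fRel] at *
      linear_combination (X 2 ^ 2 + X 2) * h
    · refine ⟨n, q * X 1, g * X 2, ?_⟩
      simp only [map_mul, i1, Fin.reduceFinMk]
      linear_combination X 2 * h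

theorem phi_fRel : phiInv fRel = 0 := by
  simp only [fRel, map_sub, map_mul, map_pow, phi_X0, phi_X1, phi_X2]
  linear_combination (mkSL2 (X 1) * mkSL2 (X 2)) * mkSL2_rel

abbrev KK := FractionRing (MvPolynomial (Fin 2) ℂ)

theorem phi_iot_inj (q : MvPolynomial (Fin 2) ℂ) (h : phiInv (iot q) = 0) : q = 0 := by
  let x : KK := algebraMap (MvPolynomial (Fin 2) ℂ) KK (X 0)
  let z : KK := algebraMap (MvPolynomial (Fin 2) ℂ) KK (X 1)
  have hx : x ≠ 0 := by
    intro h0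
    exact X_ne_zero (R := ℂ) (0 : Fin 2) ((IsFractionRing.injective _ KK) (h0.trans (map_zero _).symm))
  let F : SL2Ring →ₐ[ℂ] KK := liftSL2 ![x, z, 1, (z + 1) / x] (by
    simp
    field_simp
    ring)
  have e : (F.comp phiInv).comp iot = IsScalarTower.toAlgHom ℂ (MvPolynomial (Fin 2) ℂ) KK := by
    apply MvPolynomial.algHom_ext
    intro i
    fin_cases i
    · simp [iot, phi_X0, F, liftSL2_X, x]
    · simp [iot, phi_X2, F, liftSL2_X, z]
  have h2 := DFunLike.congr_fun e q
  simp only [AlgHom.comp_apply, h, map_zero] at h2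
  exact (IsFractionRing.injective _ KK) (h2.symm.trans (map_zero _).symm)

theorem ker_phi : RingHom.ker phiInv = Ideal.span {fRel} := by
  apply le_antisymm
  · intro p hp
    rw [RingHom.mem_ker] at hp
    obtain ⟨n, q, g, h⟩ := reduce p
    have h1 := congrArg phiInv h
    rw [map_mul, hp, map_add, map_mul, phi_fRel, mul_zero, zero_mul, add_zero] at h1
    rw [phi_iot_inj q h1.symm, map_zero, zero_add] at h
    have hnd : ¬ (X 0 : MvPolynomial (Fin 3) ℂ) ∣ fRel := by
      rintro ⟨c, hc⟩
      have := congrArg (eval ![0, 0, 1]) hc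
      simp [fRel] at this
      norm_num at this
    obtain ⟨g', rfl⟩ := (MvPolynomial.X_prime (R := ℂ) (i := (0 : Fin 3))).pow_dvd_of_dvd_mul_left n hnd ⟨p, h.symm⟩
    rw [Ideal.mem_span_singleton]
    refine ⟨g', mul_left_cancel₀ (pow_ne_zero n (X_ne_zero (R := ℂ) (0 : Fin 3))) ?_⟩
    rw [h]; ring
  · rw [Ideal.span_singleton_le_iff_mem, RingHom.mem_ker, phi_fRel]

/-! image -/

theorem mon_mem (n : ℕ) : ∀ i j k l : ℕ, i + j = n → k + l = n →
    mkSL2 (X 0) ^ i * mkSL2 (X 1) ^ j * mkSL2 (X 2) ^ k * mkSL2 (X 3) ^ l ∈ phiInv.range := by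
  have h02 : mkSL2 (X 0) * mkSL2 (X 2) ∈ phiInv.range := ⟨X 0, phi_X0⟩
  have h13 : mkSL2 (X 1) * mkSL2 (X 3) ∈ phiInv.range := ⟨X 1, phi_X1⟩
  have h12 : mkSL2 (X 1) * mkSL2 (X 2) ∈ phiInv.range := ⟨X 2, phi_X2⟩
  have h03 : mkSL2 (X 0) * mkSL2 (X 3) ∈ phiInv.range := by
    rw [sub_eq_iff_eq_add.mp mkSL2_rel]
    exact add_mem (one_mem _) h12
  induction n with
  | zero =>
    intro i j k l h h'
    obtain ⟨rfl, rfl⟩ := Nat.add_eq_zero_iff.mp h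
    obtain ⟨rfl, rfl⟩ := Nat.add_eq_zero_iff.mp h'
    simp [one_mem]
  | succ n ih =>
    intro i j k l h h'
    rcases i with _ | i
    · obtain rfl : j = n + 1 := by omega
      rcases k with _ | k
      · obtain rfl : l = n + 1 := by omega
        convert mul_mem (ih 0 n 0 n (by omega) (by omega)) h13 using 1
        ring
      · convert mul_mem (ih 0 n k l (by omega) (by omega)) h12 using 1
        ring
    · rcases k with _ | k
      · obtain rfl : l = n + 1 := by omega
        convert mul_mem (ih i j 0 n (by omega) (by omega)) h03 using 1
        ring
      · convert mul_mem (ih i j k l (by omega) (by omega)) h02 using 1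
        ring

noncomputable def two : ℂˣ := Units.mk0 2 two_ne_zero

theorem decomp (p : MvPolynomial (Fin 4) ℂ) : ∃ q ∈ phiInv.range,
    mkSL2 p - q ∈ ⨆ μ : ℂ, ⨆ _ : μ ≠ 1, Module.End.eigenspace (sgHom two).toLinearMap μ := by
  induction p using MvPolynomial.induction_on' with
  | add p p' h h' =>
    obtain ⟨q, hq, h⟩ := h
    obtain ⟨q', hq', h'⟩ := h'
    refine ⟨q + q', add_mem hq hq', ?_⟩
    rw [map_add, add_sub_add_comm]
    exact add_mem h h'
  | monomial e c =>
    have hm : mkSL2 (monomial e c) = c • (mkSL2 (X 0) ^ (e 0) * mkSL2 (X 1) ^ (e 1) *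
        mkSL2 (X 2) ^ (e 2) * mkSL2 (X 3) ^ (e 3)) := by
      rw [monomial_eq, Finsupp.prod_fintype _ _ (by simp), Fin.prod_univ_four, ← smul_eq_C_mul]
      simp only [← map_pow, ← map_mul]
      rfl
    rw [hm]
    by_cases hw : e 0 + e 1 = e 2 + e 3
    · exact ⟨_, Subalgebra.smul_mem _ (mon_mem _ _ _ _ _ rfl hw.symm) c, by simp⟩
    · refine ⟨0, zero_mem _, ?_⟩
      rw [sub_zero]
      refine Submodule.smul_mem _ _ ?_
      refine Submodule.mem_iSup_of_mem ((2:ℂ) ^ (e 0 + e 1) * (2:ℂ)⁻¹ ^ (e 2 + e 3))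
        (Submodule.mem_iSup_of_mem ?_ ?_)
      · intro h1
        rw [inv_pow, mul_inv_eq_one₀ (pow_ne_zero _ two_ne_zero)] at h1
        apply hw
        have h3 : (2:ℕ) ^ (e 0 + e 1) = 2 ^ (e 2 + e 3) := by exact_mod_cast h1
        exact Nat.pow_right_injective le_rfl h3
      · rw [Module.End.mem_eigenspace_iff]
        simp only [AlgHom.toLinearMap_apply, map_mul, map_pow, sgHom_X]
        simp [wtU, two, smul_pow, smul_smul, mul_smul_comm, smul_mul_assoc]
        congr 1
        ring

theorem phi_invariant (t : ℂˣ) (p : MvPolynomial (Fin 3) ℂ) :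
    sgHom t (phiInv p) = phiInv p := by
  have : (sgHom t).comp phiInv = phiInv := by
    apply MvPolynomial.algHom_ext
    intro i
    fin_cases i
    · simp [phi_X0, sgHom_X, wtU, smul_cancel]
    · simp [phi_X1, sgHom_X, wtU, smul_cancel]
    · simp [phi_X2, sgHom_X, wtU, smul_cancel]
  exact DFunLike.congr_fun this p

theorem inv_mem (r : SL2Ring) (h : sgHom two r = r) : r ∈ phiInv.range := by
  obtain ⟨p, rfl⟩ := Ideal.Quotient.mk_surjective r
  obtain ⟨q, hq, hd⟩ := decomp p
  have hq' : sgHom two q = q := by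
    obtain ⟨s, rfl⟩ := hq
    exact phi_invariant _ s
  have h1 : mkSL2 p - q ∈ Module.End.eigenspace (sgHom two).toLinearMap 1 := by
    rw [Module.End.mem_eigenspace_iff, one_smul, AlgHom.toLinearMap_apply, map_sub, hq']
    exact congrArg (· - q) h
  have h0 := Submodule.disjoint_def.mp
    (Module.End.eigenspaces_iSupIndep (sgHom two).toLinearMap 1) _ h1 hd
  have : mkSL2 p = q := sub_eq_zero.mp h0
  change mkSL2 p ∈ _
  rw [this]; exact hq

/-- For each `t ∈ ℂˣ` the assignment `aᵢ ↦ t·aᵢ`, `bᵢ ↦ t⁻¹·bᵢ` defines a `ℂ`-algebra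
automorphism `σ_t` of the coordinate ring `R` of `SL₂(ℂ)`; the map
`φ : ℂ[U,V,Z] → R` with `U ↦ a₁b₁`, `V ↦ a₂b₂`, `Z ↦ a₂b₁` has kernel the principal
ideal `(UV − Z² − Z)` and image the subalgebra of `σ`-invariants. -/
theorem stmt11 :
    ∃ σ : ℂˣ → (SL2Ring ≃ₐ[ℂ] SL2Ring),
      (∀ t : ℂˣ,
        σ t (mkSL2 (X 0)) = (t : ℂ) • mkSL2 (X 0) ∧
        σ t (mkSL2 (X 1)) = (t : ℂ) • mkSL2 (X 1) ∧
        σ t (mkSL2 (X 2)) = ((t⁻¹ : ℂˣ) : ℂ) • mkSL2 (X 2) ∧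
        σ t (mkSL2 (X 3)) = ((t⁻¹ : ℂˣ) : ℂ) • mkSL2 (X 3)) ∧
      RingHom.ker phiInv = Ideal.span {X 0 * X 1 - X 2 ^ 2 - X 2} ∧
      (phiInv.range : Set SL2Ring) = {r : SL2Ring | ∀ t : ℂˣ, σ t r = r} := by
  refine ⟨sgEquiv, fun t => ⟨sgHom_X t 0, sgHom_X t 1, sgHom_X t 2, sgHom_X t 3⟩, ker_phi, ?_⟩
  ext r
  constructor
  · rintro ⟨p, rfl⟩ t
    exact phi_invariant t p
  · intro h
    exact inv_mem r (h two)
end
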